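/- Let T be a triangle. Given any (f,g) ∈ (H^2×H^1)(∂T) and ρ ∈ L₂(T), there exists a unique ξ ∈ H²(T) such that (Δξ, Δz)_{L₂(T)} = (ρ, z)_{L₂(T)} for all z ∈ H²₀(T) and Tr ξ = (f,g). -/

import Mathlib

open MeasureTheory Real Set
open scoped RealInnerProductSpace
noncomputable section

abbrev E2 := EuclideanSpace ℝ (Fin 2)
def stdb2 (i : Fin 2) : E2 := EuclideanSpace.single i 1
def L2on {n : ℕ} (Ω : Set (EuclideanSpace ℝ (Fin n))) (u : EuclideanSpace ℝ (Fin n) → ℝ) : Prop :=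
  MemLp u 2 (volume.restrict Ω)
def IsWeakD {n : ℕ} (Ω : Set (EuclideanSpace ℝ (Fin n)))
    (u v : EuclideanSpace ℝ (Fin n) → ℝ) (d : EuclideanSpace ℝ (Fin n)) : Prop :=
  ∀ φ : EuclideanSpace ℝ (Fin n) → ℝ, ContDiff ℝ (⊤ : ℕ∞) φ → HasCompactSupport φ → tsupport φ ⊆ Ω →
    ∫ x in Ω, u x * fderiv ℝ φ x d = - ∫ x in Ω, v x * φ x
def tri (p : Fin 3 → E2) : Set E2 := interior (convexHull ℝ (range p))
def evec (p : Fin 3 → E2) (i : Fin 3) : E2 := p (i + 2) - p (i + 1)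
def elen (p : Fin 3 → E2) (i : Fin 3) : ℝ := ‖evec p i‖
def tangv (p : Fin 3 → E2) (i : Fin 3) : E2 := (elen p i)⁻¹ • evec p i
def norv (p : Fin 3 → E2) (i : Fin 3) : E2 :=
  EuclideanSpace.single 0 (tangv p i 1) + EuclideanSpace.single 1 (-(tangv p i 0))
def epar (p : Fin 3 → E2) (i : Fin 3) (t : ℝ) : E2 := p (i + 1) + t • evec p i
def ccw (p : Fin 3 → E2) : Prop :=
  0 < (p 1 - p 0) 0 * (p 2 - p 0) 1 - (p 1 - p 0) 1 * (p 2 - p 0) 0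
def tau (i j : Fin 3) : ℝ := if i = j + 1 then 0 else 1

/-- weak derivative on an open interval of `ℝ` -/
def IsWeakD1 (S : Set ℝ) (u v : ℝ → ℝ) : Prop :=
  ∀ φ : ℝ → ℝ, ContDiff ℝ (⊤ : ℕ∞) φ → HasCompactSupport φ → tsupport φ ⊆ S →
    ∫ t in S, u t * deriv φ t = - ∫ t in S, v t * φ t

def MemHedge : ℕ → (ℝ → ℝ) → Prop
  | 0, u => MemLp u 2 (volume.restrict (Ioo (0:ℝ) 1))
  | (k+1), u => MemLp u 2 (volume.restrict (Ioo (0:ℝ) 1)) ∧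
      ∃ v, IsWeakD1 (Ioo (0:ℝ) 1) u v ∧ MemHedge k v

/-- membership of edgewise data in `H²(∂T) × H¹(∂T)` (with pointwise C¹/C⁰ representatives) -/
def MemBdryH2H1 (f g : Fin 3 → ℝ → ℝ) : Prop :=
  ∀ i, MemHedge 2 (f i) ∧ ContDiffOn ℝ 1 (f i) (Icc 0 1) ∧
    MemHedge 1 (g i) ∧ ContinuousOn (g i) (Icc 0 1)

/-- compatibility conditions (2.2)-(2.4) -/
def Compat (p : Fin 3 → E2) (f g : Fin 3 → ℝ → ℝ) : Prop :=
  (∀ i j k : Fin 3, j ≠ i → k ≠ i → f j (tau i j) = f k (tau i k)) ∧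
  ∃ w : Fin 3 → E2, ∀ i j : Fin 3, j ≠ i →
    derivWithin (f j) (Icc 0 1) (tau i j) = elen p j * ⟪w i, tangv p j⟫ ∧
    g j (tau i j) = ⟪w i, norv p j⟫

/-- `H²` membership with explicit weak gradient and Hessian data -/
def MemH2W {n : ℕ} (Ω : Set (EuclideanSpace ℝ (Fin n))) (ξ : EuclideanSpace ℝ (Fin n) → ℝ)
    (G : Fin n → EuclideanSpace ℝ (Fin n) → ℝ)
    (Hs : Fin n → Fin n → EuclideanSpace ℝ (Fin n) → ℝ) : Prop :=
  L2on Ω ξ ∧ (∀ d, L2on Ω (G d) ∧ IsWeakD Ω ξ (G d) (EuclideanSpace.single d 1)) ∧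
  ∀ d d', L2on Ω (Hs d d') ∧ IsWeakD Ω (G d) (Hs d d') (EuclideanSpace.single d' 1)

/-- Gagliardo-type `H^{1/2}` seminorm finiteness for functions on a domain in `ℝⁿ` -/
def GagH12 {n : ℕ} (Ω : Set (EuclideanSpace ℝ (Fin n))) (u : EuclideanSpace ℝ (Fin n) → ℝ) : Prop :=
  Integrable (fun q : EuclideanSpace ℝ (Fin n) × EuclideanSpace ℝ (Fin n) =>
    (u q.1 - u q.2) ^ 2 / ‖q.1 - q.2‖ ^ (n + 1)) ((volume.restrict Ω).prod (volume.restrict Ω))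

/-- membership in `H^{5/2}` of a domain: weak `H²` data whose second derivatives have finite
`H^{1/2}` Gagliardo seminorm. -/
def MemH52 {n : ℕ} (Ω : Set (EuclideanSpace ℝ (Fin n))) (ζ : EuclideanSpace ℝ (Fin n) → ℝ) : Prop :=
  ∃ G Hs, MemH2W Ω ζ G Hs ∧ ∀ d d', GagH12 Ω (Hs d d')

/-- pointwise trace relation `Tr ζ = (f,g)` on `∂T` for a `C¹` function -/
def TraceEq (p : Fin 3 → E2) (ζ : E2 → ℝ) (f g : Fin 3 → ℝ → ℝ) : Prop :=
  ∀ i : Fin 3, ∀ t ∈ Icc (0:ℝ) 1,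
    ζ (epar p i t) = f i t ∧ fderiv ℝ ζ (epar p i t) (norv p i) = g i t

/-- the vector field 𝔤 (2.11) on edge `i`, at parameter `t` -/
def gfield (p : Fin 3 → E2) (f g : Fin 3 → ℝ → ℝ) (i : Fin 3) (t : ℝ) : E2 :=
  ((elen p i)⁻¹ * derivWithin (f i) (Icc 0 1) t) • tangv p i + g i t • norv p i

/-- the Laplacian of a (smooth) function on `E2` -/
def lap (φ : E2 → ℝ) (x : E2) : ℝ :=
  ∑ i : Fin 2, fderiv ℝ (fun y => fderiv ℝ φ y (stdb2 i)) x (stdb2 i)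

/-- `bu` is the edgewise boundary trace of `u` on `∂T` (in the parametrization `epar`),
expressed through the divergence theorem; `Du` is the weak gradient of `u` on `T`. -/
def HasFaceTrace (p : Fin 3 → E2) (u : E2 → ℝ) (Du : Fin 2 → E2 → ℝ)
    (bu : Fin 3 → ℝ → ℝ) : Prop :=
  ∀ φ : E2 → ℝ, ContDiff ℝ (⊤ : ℕ∞) φ → HasCompactSupport φ → ∀ d : Fin 2,
    ∫ x in tri p, (u x * fderiv ℝ φ x (stdb2 d) + Du d x * φ x)
      = ∑ j : Fin 3, elen p j * ∫ t in Ioo (0:ℝ) 1, bu j t * φ (epar p j t) * norv p j d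

/-- `Tr ξ = (f,g)` in the weak (integration by parts) sense: the boundary trace of `ξ`
is `f` and the boundary trace of its gradient is `(∂f/∂t) t + g n` (cf. (2.5), (2.11)). -/
def TraceW (p : Fin 3 → E2) (ξ : E2 → ℝ) (G : Fin 2 → E2 → ℝ)
    (Hs : Fin 2 → Fin 2 → E2 → ℝ) (f g : Fin 3 → ℝ → ℝ) : Prop :=
  HasFaceTrace p ξ G f ∧
  ∀ d : Fin 2, HasFaceTrace p (G d) (fun d' => Hs d d') (fun j t => gfield p f g j t d)

def Dt (p : Fin 3 → E2) : ℝ := (p 1 - p 0) 0 * (p 2 - p 0) 1 - (p 1 - p 0) 1 * (p 2 - p 0) 0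

/-- the affine parametrization of the triangle -/
def Psi (p : Fin 3 → E2) (x : E2) : E2 := p 0 + (x 0 • (p 1 - p 0) + x 1 • (p 2 - p 0))

def PsiL (p : Fin 3 → E2) : E2 →L[ℝ] E2 :=
  ((EuclideanSpace.proj 0 : E2 →L[ℝ] ℝ)).smulRight (p 1 - p 0) +
  ((EuclideanSpace.proj 1 : E2 →L[ℝ] ℝ)).smulRight (p 2 - p 0)

lemma Psi_eq (p : Fin 3 → E2) (x : E2) : Psi p x = p 0 + PsiL p x := by
  simp [Psi, PsiL]

lemma PsiL_det (p : Fin 3 → E2) : (PsiL p).det = Dt p := by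
  have h := LinearMap.det_toMatrix (EuclideanSpace.basisFun (Fin 2) ℝ).toBasis (PsiL p : E2 →ₗ[ℝ] E2)
  rw [ContinuousLinearMap.det, ← h, Matrix.det_fin_two]
  simp [LinearMap.toMatrix_apply, PsiL, Dt]
  ring

lemma Psi_hasFDeriv (p : Fin 3 → E2) (x : E2) : HasFDerivAt (Psi p) (PsiL p) x := by
  have : Psi p = fun x => p 0 + PsiL p x := funext (Psi_eq p)
  rw [this]
  exact (PsiL p).hasFDerivAt.const_add _

def refT : Set E2 := {x | 0 ≤ x 0 ∧ 0 ≤ x 1 ∧ x 0 + x 1 ≤ 1}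

lemma hull_eq (p : Fin 3 → E2) : convexHull ℝ (range p) = Psi p '' refT := by
  apply Subset.antisymm
  · apply convexHull_min
    · rintro _ ⟨i, rfl⟩
      fin_cases i
      · exact ⟨0, by simp [refT], by simp [Psi]⟩
      · exact ⟨EuclideanSpace.single 0 1, by simp [refT], by simp [Psi]⟩
      · exact ⟨EuclideanSpace.single 1 1, by simp [refT], by simp [Psi]⟩
    · rintro _ ⟨x, hx, rfl⟩ _ ⟨y, hy, rfl⟩ a b ha hb hab
      refine ⟨a • x + b • y, ?_, ?_⟩
      · obtain ⟨h1, h2, h3⟩ := hx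
        obtain ⟨h4, h5, h6⟩ := hy
        refine ⟨?_, ?_, ?_⟩ <;> simp
        · positivity
        · positivity
        · nlinarith
      · rw [Psi_eq, Psi_eq, Psi_eq, map_add, map_smul, map_smul, smul_add, smul_add]
        have : p 0 = a • p 0 + b • p 0 := by rw [← add_smul, hab, one_smul]
        nth_rw 1 [this]
        abel
  · rintro _ ⟨x, ⟨h1, h2, h3⟩, rfl⟩
    have hc := convex_convexHull ℝ (range p)
    have hm : ∀ i, p i ∈ convexHull ℝ (range p) := fun i => subset_convexHull ℝ _ ⟨i, rfl⟩
    have := hc.sum_mem (t := Finset.univ) (w := ![1 - x 0 - x 1, x 0, x 1]) (z := p)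
      (by intro i _; fin_cases i <;> simp <;> linarith)
      (by simp [Fin.sum_univ_three]; ring)
      (fun i _ => hm i)
    convert this using 1
    simp only [Fin.sum_univ_three, Psi, Matrix.cons_val_zero, Matrix.cons_val_one, Matrix.cons_val]
    module

lemma Psi_inj {p : Fin 3 → E2} (hp : ccw p) : Function.Injective (Psi p) := by
  intro x y h
  have h' : PsiL p (x - y) = 0 := by
    rw [Psi_eq, Psi_eq] at h
    rw [map_sub, sub_eq_zero]; exact add_left_cancel h
  have hd : (PsiL p).det ≠ 0 := by rw [PsiL_det]; exact ne_of_gt hp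
  have hi := (LinearMap.equivOfDetNeZero (PsiL p : E2 →ₗ[ℝ] E2) hd).injective
  exact sub_eq_zero.1 (hi (h'.trans (map_zero _).symm))

lemma refT_closed : IsClosed refT := by
  have h0 : Continuous fun x : E2 => x 0 := by fun_prop
  have h1 : Continuous fun x : E2 => x 1 := by fun_prop
  exact (isClosed_le continuous_const h0).inter
    ((isClosed_le continuous_const h1).inter (isClosed_le (h0.add h1) continuous_const))

lemma tri_ae (p : Fin 3 → E2) : tri p =ᵐ[volume] convexHull ℝ (range p) :=
  interior_ae_eq_of_null_frontier ((convex_convexHull ℝ _).addHaar_frontier volume)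

lemma int_tri {p : Fin 3 → E2} (hp : ccw p) (F : E2 → ℝ) :
    ∫ x in tri p, F x = Dt p * ∫ x in refT, F (Psi p x) := by
  rw [setIntegral_congr_set (tri_ae p), hull_eq,
    integral_image_eq_integral_abs_det_fderiv_smul volume refT_closed.measurableSet
      (fun x _ => (Psi_hasFDeriv p x).hasFDerivWithinAt) (Psi_inj hp).injOn]
  simp only [PsiL_det, smul_eq_mul]
  rw [integral_const_mul, abs_of_pos (show 0 < Dt p from hp)]

/-- integral over the reference triangle as an iterated integral -/
def e2p : E2 ≃ᵐ ℝ × ℝ := (MeasurableEquiv.toLp 2 (Fin 2 → ℝ)).symm.trans (MeasurableEquiv.finTwoArrow)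

lemma e2p_mp : MeasurePreserving e2p volume volume :=
  (EuclideanSpace.volume_preserving_symm_measurableEquiv_toLp (Fin 2)).trans
    (volume_preserving_finTwoArrow ℝ)

lemma e2p_apply (x : E2) : e2p x = (x 0, x 1) := rfl

lemma int_E2 (F : ℝ → ℝ → ℝ) : ∫ x : E2, F (x 0) (x 1) = ∫ z : ℝ × ℝ, F z.1 z.2 :=
  e2p_mp.integral_comp' (f := e2p) (fun z : ℝ × ℝ => F z.1 z.2)

def refP : Set (ℝ × ℝ) := {z | 0 ≤ z.1 ∧ 0 ≤ z.2 ∧ z.1 + z.2 ≤ 1}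

lemma refP_closed : IsClosed refP :=
  (isClosed_le continuous_const continuous_fst).inter
    ((isClosed_le continuous_const continuous_snd).inter
      (isClosed_le (continuous_fst.add continuous_snd) continuous_const))

lemma refP_sub : refP ⊆ Icc (0:ℝ) 1 ×ˢ Icc (0:ℝ) 1 := by
  rintro ⟨a, b⟩ ⟨h1, h2, h3⟩
  simp only at h1 h2 h3
  exact ⟨⟨h1, by simp; linarith⟩, ⟨h2, by simp; linarith⟩⟩

lemma refP_compact : IsCompact refP :=
  (isCompact_Icc.prod isCompact_Icc).of_isClosed_subset refP_closed refP_sub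

lemma int_refT (F : ℝ → ℝ → ℝ) : ∫ x in refT, F (x 0) (x 1) = ∫ z in refP, F z.1 z.2 := by
  have := e2p_mp.setIntegral_preimage_emb e2p.measurableEmbedding
    (fun z : ℝ × ℝ => F z.1 z.2) refP
  exact this

lemma int_refP_fst {F F' : ℝ → ℝ → ℝ} (hc : Continuous fun z : ℝ × ℝ => F' z.1 z.2)
    (hd : ∀ s t, HasDerivAt (fun s => F s t) (F' s t) s) :
    ∫ z in refP, F' z.1 z.2 = ∫ t in Ioo (0:ℝ) 1, (F (1 - t) t - F 0 t) := by
  rw [← integral_indicator refP_closed.measurableSet]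
  have hInt0 : Integrable (refP.indicator fun z : ℝ × ℝ => F' z.1 z.2) (volume.prod volume) := by
    have : IntegrableOn (fun z : ℝ × ℝ => F' z.1 z.2) refP volume :=
      hc.continuousOn.integrableOn_compact refP_compact
    exact this.integrable_indicator refP_closed.measurableSet
  rw [Measure.volume_eq_prod, integral_prod_symm _ hInt0, ← integral_indicator measurableSet_Ioo]
  apply integral_congr_ae
  have h0 : ∀ᵐ t : ℝ, t ≠ 0 ∧ t ≠ 1 := by
    rw [Filter.eventually_and]
    exact ⟨Measure.ae_ne volume 0, Measure.ae_ne volume 1⟩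
  filter_upwards [h0] with t ht
  by_cases h : t ∈ Ioo (0:ℝ) 1
  · rw [indicator_of_mem h]
    have : (fun s => refP.indicator (fun z : ℝ × ℝ => F' z.1 z.2) (s, t)) =
        (Icc 0 (1 - t)).indicator (fun s => F' s t) := by
      ext s
      by_cases hs : s ∈ Icc 0 (1 - t)
      · rw [indicator_of_mem hs, indicator_of_mem]
        exact ⟨hs.1, h.1.le, by simp; linarith [hs.2]⟩
      · rw [indicator_of_notMem hs, indicator_of_notMem]
        rintro ⟨h1, h2, h3⟩
        exact hs ⟨h1, by simp at h3; linarith⟩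
    rw [this, integral_indicator measurableSet_Icc, integral_Icc_eq_integral_Ioc,
      ← intervalIntegral.integral_of_le (by linarith [h.2])]
    apply intervalIntegral.integral_eq_sub_of_hasDerivAt (fun s _ => hd s t)
    exact (hc.comp (by fun_prop : Continuous fun s : ℝ => (s, t))).intervalIntegrable _ _
  · rw [indicator_of_notMem h]
    have : (fun s => refP.indicator (fun z : ℝ × ℝ => F' z.1 z.2) (s, t)) = 0 := by
      ext s
      rw [indicator_of_notMem]; rfl
      rintro ⟨h1, h2, h3⟩
      simp only at h1 h2 h3
      apply h
      exact ⟨lt_of_le_of_ne h2 (Ne.symm ht.1), lt_of_le_of_ne (by linarith) ht.2⟩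
    rw [this]; simp

lemma int_refP_snd {F F' : ℝ → ℝ → ℝ} (hc : Continuous fun z : ℝ × ℝ => F' z.1 z.2)
    (hd : ∀ s t, HasDerivAt (fun t => F s t) (F' s t) t) :
    ∫ z in refP, F' z.1 z.2 = ∫ t in Ioo (0:ℝ) 1, (F t (1 - t) - F t 0) := by
  have h := (Measure.measurePreserving_swap (μ := (volume : Measure ℝ)) (ν := (volume : Measure ℝ))).setIntegral_preimage_emb
    MeasurableEquiv.prodComm.measurableEmbedding (fun z : ℝ × ℝ => F' z.1 z.2) refP
  have hpre : Prod.swap ⁻¹' refP = refP := by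
    ext ⟨a, b⟩
    simp only [refP, mem_preimage, mem_ofPred_eq, Prod.fst_swap, Prod.snd_swap]
    constructor <;> rintro ⟨h1, h2, h3⟩ <;> exact ⟨h2, h1, by linarith⟩
  rw [hpre] at h
  rw [Measure.volume_eq_prod, ← h]
  have := int_refP_fst (F := fun s t => F t s) (F' := fun s t => F' t s)
    (hc.comp continuous_swap) (fun s t => hd t s)
  rw [Measure.volume_eq_prod] at this
  exact this

def Nv (p : Fin 3 → E2) (j : Fin 3) (v : E2) : ℝ := evec p j 1 * v 0 - evec p j 0 * v 1

lemma Psi_par (p : Fin 3 → E2) (s t : ℝ) : Psi p !₂[s, t] = p 0 + (s • (p 1 - p 0) + t • (p 2 - p 0)) := by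
  simp [Psi]

lemma int_reflect (F : ℝ → ℝ) : ∫ t in Ioo (0:ℝ) 1, F (1 - t) = ∫ t in Ioo (0:ℝ) 1, F t := by
  rw [← integral_Ioc_eq_integral_Ioo, ← integral_Ioc_eq_integral_Ioo,
    ← intervalIntegral.integral_of_le zero_le_one, ← intervalIntegral.integral_of_le zero_le_one]
  simp

lemma epar_cont (p : Fin 3 → E2) (j : Fin 3) : Continuous (epar p j) := by
  unfold epar; fun_prop

lemma div_tri {p : Fin 3 → E2} (hp : ccw p) {F : E2 → ℝ} (hF : ContDiff ℝ 1 F) (v : E2) :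
    ∫ x in tri p, fderiv ℝ F x v
      = ∑ j : Fin 3, Nv p j v * ∫ t in Ioo (0:ℝ) 1, F (epar p j t) := by
  have hfc : Continuous (fderiv ℝ F) := hF.continuous_fderiv (by norm_num)
  have hD : ∀ x, HasFDerivAt F (fderiv ℝ F x) x := fun x =>
    (hF.differentiable (by norm_num) x).hasFDerivAt
  set a := p 1 - p 0 with ha
  set b := p 2 - p 0 with hb
  have hQc : Continuous fun z : ℝ × ℝ => p 0 + (z.1 • a + z.2 • b) := by fun_prop
  have e0 : ∀ t, epar p 0 t = p 0 + ((1 - t) • a + t • b) := by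
    intro t; simp only [epar, evec, ha, hb]; simp; module
  have e1 : ∀ t, epar p 1 t = p 0 + ((0:ℝ) • a + (1 - t) • b) := by
    intro t; simp only [epar, evec, ha, hb]
    rw [show (1 + 1 : Fin 3) = 2 from rfl, show (1 + 2 : Fin 3) = 0 from rfl]; module
  have e2 : ∀ t, epar p 2 t = p 0 + (t • a + (0:ℝ) • b) := by
    intro t; simp only [epar, evec, ha, hb]
    rw [show (2 + 1 : Fin 3) = 0 from rfl, show (2 + 2 : Fin 3) = 1 from rfl]; module
  have hi : ∀ j, IntegrableOn (fun t => F (epar p j t)) (Ioo (0:ℝ) 1) := fun j =>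
    ((hF.continuous.comp (epar_cont p j)).continuousOn.integrableOn_compact
      isCompact_Icc).mono_set Ioo_subset_Icc_self
  -- direction a
  have hA : ∫ x in tri p, fderiv ℝ F x a = Dt p * ((∫ t in Ioo (0:ℝ) 1, F (epar p 0 t)) -
      ∫ t in Ioo (0:ℝ) 1, F (epar p 1 t)) := by
    rw [int_tri hp]
    congr 1
    have := int_refT (fun s t => fderiv ℝ F (p 0 + (s • a + t • b)) a)
    rw [show (fun x : E2 => fderiv ℝ F (Psi p x) a) =
      fun x : E2 => fderiv ℝ F (p 0 + (x 0 • a + x 1 • b)) a from rfl, this,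
      int_refP_fst (F := fun s t => F (p 0 + (s • a + t • b)))
        (F' := fun s t => fderiv ℝ F (p 0 + (s • a + t • b)) a)
        ((hfc.comp hQc).clm_apply continuous_const)]
    · rw [← int_reflect (fun t => F (epar p 1 t)), integral_sub]
      · simp only [e0, e1]; simp
      · have := hi 0
        simp only [e0] at this
        exact this
      · exact ((hF.continuous.comp (hQc.comp (by fun_prop : Continuous fun t : ℝ => ((0:ℝ), t)))).continuousOn.integrableOn_compact isCompact_Icc).mono_set Ioo_subset_Icc_self
    · intro s t
      have h1 : HasDerivAt (fun s : ℝ => p 0 + (s • a + t • b)) a s := by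
        have := (((hasDerivAt_id s).smul_const a).add_const (t • b)).const_add (p 0)
        simpa using this
      exact (hD _).comp_hasDerivAt s h1
  have hB : ∫ x in tri p, fderiv ℝ F x b = Dt p * ((∫ t in Ioo (0:ℝ) 1, F (epar p 0 t)) -
      ∫ t in Ioo (0:ℝ) 1, F (epar p 2 t)) := by
    rw [int_tri hp]
    congr 1
    have := int_refT (fun s t => fderiv ℝ F (p 0 + (s • a + t • b)) b)
    rw [show (fun x : E2 => fderiv ℝ F (Psi p x) b) =
      fun x : E2 => fderiv ℝ F (p 0 + (x 0 • a + x 1 • b)) b from rfl, this,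
      int_refP_snd (F := fun s t => F (p 0 + (s • a + t • b)))
        (F' := fun s t => fderiv ℝ F (p 0 + (s • a + t • b)) b)
        ((hfc.comp hQc).clm_apply continuous_const)]
    · rw [← int_reflect (fun t => F (epar p 0 t)), integral_sub]
      · simp only [e0, e2]; simp
      · exact ((hF.continuous.comp (hQc.comp (by fun_prop : Continuous fun t : ℝ => (t, 1 - t)))).continuousOn.integrableOn_compact isCompact_Icc).mono_set Ioo_subset_Icc_self
      · have := hi 2
        simp only [e2] at this
        exact this
    · intro s t
      have h1 : HasDerivAt (fun t : ℝ => p 0 + (s • a + t • b)) b t := by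
        have := (((hasDerivAt_id t).smul_const b).const_add (s • a)).const_add (p 0)
        simpa using this
      exact (hD _).comp_hasDerivAt t h1
  -- general direction
  have hD0 : Dt p ≠ 0 := ne_of_gt hp
  have hDe : Dt p = a 0 * b 1 - a 1 * b 0 := rfl
  set α := (v 0 * b 1 - v 1 * b 0) / Dt p with hα
  set β := (a 0 * v 1 - a 1 * v 0) / Dt p with hβ
  have hv : v = α • a + β • b := by
    ext i; fin_cases i
    · simp [hα, hβ]; field_simp; rw [hDe]; ring
    · simp [hα, hβ]; field_simp; rw [hDe]; ring
  have hci : ∀ w, IntegrableOn (fun x => fderiv ℝ F x w) (tri p) := by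
    intro w
    have hk : IsCompact (convexHull ℝ (range p)) := (finite_range p).isCompact_convexHull ℝ
    exact ((hfc.clm_apply continuous_const).continuousOn.integrableOn_compact hk).mono_set interior_subset
  have : ∫ x in tri p, fderiv ℝ F x v = α * (∫ x in tri p, fderiv ℝ F x a) + β * ∫ x in tri p, fderiv ℝ F x b := by
    conv_lhs => rw [hv]
    simp only [map_add, map_smul, smul_eq_mul]
    rw [integral_add ((hci a).const_mul _) ((hci b).const_mul _), integral_const_mul, integral_const_mul]
  rw [this, hA, hB, Fin.sum_univ_three]
  have k0 : Nv p 0 v = v 0 * (b 1 - a 1) - v 1 * (b 0 - a 0) := by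
    simp [Nv, evec, ha, hb]; ring
  have k1 : Nv p 1 v = - (v 0 * b 1 - v 1 * b 0) := by
    simp only [Nv, evec, ha, hb]
    rw [show (1 + 1 : Fin 3) = 2 from rfl, show (1 + 2 : Fin 3) = 0 from rfl]; simp; ring
  have k2 : Nv p 2 v = - (a 0 * v 1 - a 1 * v 0) := by
    simp only [Nv, evec, ha, hb]
    rw [show (2 + 1 : Fin 3) = 0 from rfl, show (2 + 2 : Fin 3) = 1 from rfl]; simp
  rw [k0, k1, k2, hα, hβ]
  field_simp
  ring

lemma elen_norv (p : Fin 3 → E2) (j : Fin 3) (d : Fin 2) :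
    elen p j * norv p j d = Nv p j (stdb2 d) := by
  by_cases h : elen p j = 0
  · have : evec p j = 0 := norm_eq_zero.1 h
    rw [h, Nv, this]; simp
  · fin_cases d <;> simp [norv, Nv, tangv, stdb2] <;> field_simp

lemma hft_iff (p : Fin 3 → E2) (u : E2 → ℝ) (Du : Fin 2 → E2 → ℝ) (bu : Fin 3 → ℝ → ℝ) :
    HasFaceTrace p u Du bu ↔
  ∀ φ : E2 → ℝ, ContDiff ℝ (⊤ : ℕ∞) φ → HasCompactSupport φ → ∀ d : Fin 2,
    ∫ x in tri p, (u x * fderiv ℝ φ x (stdb2 d) + Du d x * φ x)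
      = ∑ j : Fin 3, Nv p j (stdb2 d) * ∫ t in Ioo (0:ℝ) 1, bu j t * φ (epar p j t) := by
  unfold HasFaceTrace
  refine forall_congr' fun φ => forall_congr' fun h1 => forall_congr' fun h2 => forall_congr' fun d => ?_
  have : ∀ j, elen p j * ∫ t in Ioo (0:ℝ) 1, bu j t * φ (epar p j t) * norv p j d =
      Nv p j (stdb2 d) * ∫ t in Ioo (0:ℝ) 1, bu j t * φ (epar p j t) := by
    intro j
    rw [integral_mul_const, ← elen_norv]; ring
  simp only [this]

lemma tri_open (p : Fin 3 → E2) : IsOpen (tri p) := isOpen_interior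
lemma tri_meas (p : Fin 3 → E2) : MeasurableSet (tri p) := (tri_open p).measurableSet
lemma hull_compact (p : Fin 3 → E2) : IsCompact (convexHull ℝ (range p)) :=
  (finite_range p).isCompact_convexHull ℝ
lemma tri_sub (p : Fin 3 → E2) : tri p ⊆ convexHull ℝ (range p) := interior_subset

lemma intT (p : Fin 3 → E2) {F : E2 → ℝ} (hF : Continuous F) : IntegrableOn F (tri p) :=
  (hF.continuousOn.integrableOn_compact (hull_compact p)).mono_set (tri_sub p)

lemma intI {F : ℝ → ℝ} (hF : ContinuousOn F (Icc 0 1)) : IntegrableOn F (Ioo (0:ℝ) 1) :=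
  (hF.integrableOn_compact isCompact_Icc).mono_set Ioo_subset_Icc_self

lemma tri_fin (p : Fin 3 → E2) : volume (tri p) < ⊤ :=
  (measure_mono (tri_sub p)).trans_lt (hull_compact p).measure_lt_top

instance (p : Fin 3 → E2) : IsFiniteMeasure (volume.restrict (tri p)) :=
  ⟨by simpa using tri_fin p⟩

lemma l2T (p : Fin 3 → E2) {F : E2 → ℝ} (hF : Continuous F) : L2on (tri p) F := by
  obtain ⟨C, hC⟩ := (hull_compact p).exists_bound_of_continuousOn hF.continuousOn
  apply MemLp.of_bound hF.aestronglyMeasurable C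
  filter_upwards [ae_restrict_mem (tri_meas p)] with x hx
  exact hC x (tri_sub p hx)

lemma hft_C1 {p : Fin 3 → E2} (hp : ccw p) {u : E2 → ℝ} (hu : ContDiff ℝ 1 u) :
    HasFaceTrace p u (fun d x => fderiv ℝ u x (stdb2 d)) (fun j t => u (epar p j t)) := by
  rw [hft_iff]
  intro φ h1 h2 d
  have h1' : ContDiff ℝ 1 φ := h1.of_le (by exact_mod_cast le_top)
  have := div_tri hp (hu.mul h1') (stdb2 d)
  rw [← this]
  congr 1
  ext x
  rw [fderiv_fun_mul (hu.differentiable (by norm_num) x) (h1'.differentiable (by norm_num) x)]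
  simp; ring

lemma lint_1d {α : ℝ} (hα : α ≠ 0) (c : ℝ) {h : ℝ → ENNReal} (hh : Measurable h) :
    ∫⁻ t, h (α * t + c) = ENNReal.ofReal |α|⁻¹ * ∫⁻ t, h t := by
  have h1 := Real.map_volume_mul_left hα
  have h2 : ∫⁻ t, h (t + c) = ∫⁻ t, h t := lintegral_add_right_eq_self h c
  rw [← h2]
  have h3 : ∫⁻ t, h (t + c) ∂(Measure.map (α * ·) volume) = ∫⁻ t, h (α * t + c) :=
    lintegral_map (hh.comp (by fun_prop)) (by fun_prop)
  rw [← h3, h1, lintegral_smul_measure, abs_inv, smul_eq_mul]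

lemma L_coord (L : E2 →L[ℝ] ℝ) (x : E2) : L x = L (stdb2 0) * x 0 + L (stdb2 1) * x 1 := by
  have : x = x 0 • stdb2 0 + x 1 • stdb2 1 := by
    ext i; fin_cases i <;> simp [stdb2]
  conv_lhs => rw [this]
  simp; ring

lemma lint_ridge (p : Fin 3 → E2) {L : E2 →L[ℝ] ℝ} (hL : L ≠ 0) (c : ℝ) :
    ∃ C : ENNReal, C ≠ ⊤ ∧ ∀ h : ℝ → ENNReal, Measurable h →
      ∫⁻ x in tri p, h (L x + c) ≤ C * ∫⁻ t, h t := by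
  obtain ⟨R, hR⟩ := (hull_compact p).isBounded.subset_closedBall 0
  have hRx : ∀ x ∈ tri p, ∀ i, x i ∈ Icc (-R) R := by
    intro x hx i
    have h1 := hR (tri_sub p hx)
    rw [mem_closedBall_zero_iff] at h1
    have h2 := PiLp.norm_apply_le x i
    rw [Real.norm_eq_abs] at h2
    exact abs_le.1 (h2.trans h1)
  have key : ∀ h : ℝ → ENNReal, Measurable h → ∀ A B : Set ℝ, MeasurableSet A → MeasurableSet B →
      (∀ x ∈ tri p, x 0 ∈ A ∧ x 1 ∈ B) →
      ∫⁻ x in tri p, h (L x + c) ≤ ∫⁻ z in A ×ˢ B, h (L (stdb2 0) * z.1 + L (stdb2 1) * z.2 + c)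
        ∂(volume.prod volume) := by
    intro h hh A B hA hB hAB
    have := e2p_mp.setLIntegral_comp_preimage_emb e2p.measurableEmbedding
      (fun z : ℝ × ℝ => h (L (stdb2 0) * z.1 + L (stdb2 1) * z.2 + c)) (A ×ˢ B)
    rw [← Measure.volume_eq_prod, ← this]
    refine (lintegral_mono_set (t := e2p ⁻¹' (A ×ˢ B)) ?_).trans (le_of_eq ?_)
    · intro x hx; exact ⟨(hAB x hx).1, (hAB x hx).2⟩
    · congr 1; ext x; rw [L_coord]; rfl
  by_cases h0 : L (stdb2 0) = 0
  · have h1 : L (stdb2 1) ≠ 0 := by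
      intro h1; apply hL; ext x; rw [L_coord, h0, h1]; simp
    refine ⟨volume (Icc (-R) R) * ENNReal.ofReal |L (stdb2 1)|⁻¹, by
      exact ENNReal.mul_ne_top (by simp) (by simp), ?_⟩
    intro h hh
    refine (key h hh (Icc (-R) R) univ measurableSet_Icc MeasurableSet.univ
      (fun x hx => ⟨hRx x hx 0, trivial⟩)).trans ?_
    rw [← Measure.prod_restrict, lintegral_prod _ (by fun_prop)]
    simp only [h0, zero_mul, zero_add, Measure.restrict_univ]
    rw [lint_1d h1 c hh]
    simp; rw [mul_right_comm, mul_assoc, mul_comm]; apply le_of_eq; ring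
  · refine ⟨volume (Icc (-R) R) * ENNReal.ofReal |L (stdb2 0)|⁻¹, by
      exact ENNReal.mul_ne_top (by simp) (by simp), ?_⟩
    intro h hh
    refine (key h hh univ (Icc (-R) R) MeasurableSet.univ measurableSet_Icc
      (fun x hx => ⟨trivial, hRx x hx 1⟩)).trans ?_
    rw [← Measure.prod_restrict, lintegral_prod_symm _ (by fun_prop)]
    simp only [Measure.restrict_univ, add_assoc]
    simp only [lint_1d h0 _ hh]
    simp; apply le_of_eq; ring

lemma memLp_ridge (p : Fin 3 → E2) {L : E2 →L[ℝ] ℝ} (hL : L ≠ 0) (c : ℝ) {v : ℝ → ℝ}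
    (hvm : Measurable v) (hv : MemLp v 2 volume) : L2on (tri p) (fun x => v (L x + c)) := by
  obtain ⟨C, hC, h⟩ := lint_ridge p hL c
  have hm : Measurable fun x : E2 => L x + c := by fun_prop
  refine ⟨(hvm.comp hm).aestronglyMeasurable, ?_⟩
  have h2 := hv.2
  rw [eLpNorm_lt_top_iff_lintegral_rpow_enorm_lt_top (by norm_num) (by norm_num)] at h2 ⊢
  refine (h (fun t => ‖v t‖ₑ ^ (2:ENNReal).toReal) (by fun_prop)).trans_lt ?_
  exact ENNReal.mul_lt_top hC.lt_top h2

lemma l1_ridge (p : Fin 3 → E2) {L : E2 →L[ℝ] ℝ} (hL : L ≠ 0) (c : ℝ) :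
    ∃ C : ℝ, 0 ≤ C ∧ ∀ v : ℝ → ℝ, Measurable v → Integrable v →
      IntegrableOn (fun x => v (L x + c)) (tri p) ∧
      ∫ x in tri p, ‖v (L x + c)‖ ≤ C * ∫ t, ‖v t‖ := by
  obtain ⟨C, hC, h⟩ := lint_ridge p hL c
  have hm : Measurable fun x : E2 => L x + c := by fun_prop
  refine ⟨C.toReal, by positivity, fun v hvm hv => ?_⟩
  have h1 := h (fun t => ‖v t‖ₑ) (by fun_prop)
  have hfin : C * ∫⁻ t, ‖v t‖ₑ < ⊤ := ENNReal.mul_lt_top hC.lt_top hv.2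
  have hi : IntegrableOn (fun x => v (L x + c)) (tri p) :=
    ⟨(hvm.comp hm).aestronglyMeasurable, h1.trans_lt hfin⟩
  refine ⟨hi, ?_⟩
  rw [integral_norm_eq_lintegral_enorm hi.1, integral_norm_eq_lintegral_enorm hv.1,
    ← ENNReal.toReal_mul]
  exact ENNReal.toReal_mono hfin.ne h1

def prim (c : ℝ) (v : ℝ → ℝ) (t : ℝ) : ℝ := c + ∫ s in (0:ℝ)..t, v s

lemma prim_cont (c : ℝ) {v : ℝ → ℝ} (hv : Integrable v) : Continuous (prim c v) :=
  continuous_const.add (intervalIntegral.continuous_primitive (fun _ _ => hv.intervalIntegrable) 0)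

lemma prim_deriv (c : ℝ) {v : ℝ → ℝ} (hv : Continuous v) (t : ℝ) : HasDerivAt (prim c v) (v t) t :=
  (intervalIntegral.integral_hasDerivAt_right (hv.intervalIntegrable _ _)
    (hv.stronglyMeasurableAtFilter _ _) hv.continuousAt).const_add c

lemma prim_C1 (c : ℝ) {v : ℝ → ℝ} (hv : Continuous v) : ContDiff ℝ 1 (prim c v) := by
  rw [contDiff_one_iff_deriv]
  refine ⟨fun t => (prim_deriv c hv t).differentiableAt, ?_⟩
  rw [show deriv (prim c v) = v from funext fun t => (prim_deriv c hv t).deriv]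
  exact hv

lemma prim_diff (c : ℝ) {v w : ℝ → ℝ} (hv : Integrable v) (hw : Integrable w) (t : ℝ) :
    |prim c v t - prim c w t| ≤ ∫ s, ‖v s - w s‖ := by
  simp only [prim]
  rw [add_sub_add_left_eq_sub, ← intervalIntegral.integral_sub hv.intervalIntegrable hw.intervalIntegrable]
  rw [← Real.norm_eq_abs]
  refine (intervalIntegral.norm_integral_le_integral_norm_uIoc).trans ?_
  exact setIntegral_le_integral (hv.sub hw).norm (Filter.Eventually.of_forall fun _ => norm_nonneg _)

/-- ridge functions of `C¹` profile -/
lemma hft_ridge_C1 {p : Fin 3 → E2} (hp : ccw p) (L : E2 →L[ℝ] ℝ) (c c1 : ℝ) {v : ℝ → ℝ}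
    (hv : Continuous v) :
    HasFaceTrace p (fun x => prim c1 v (L x + c)) (fun d x => v (L x + c) * L (stdb2 d))
      (fun j t => prim c1 v (L (epar p j t) + c)) := by
  have hu : ContDiff ℝ 1 (fun x => prim c1 v (L x + c)) :=
    (prim_C1 c1 hv).comp (L.contDiff.add contDiff_const)
  have h := hft_C1 hp hu
  convert h using 3 with d x
  have h1 : HasFDerivAt (fun x => L x + c) L x := L.hasFDerivAt.add_const c
  have h2 := (prim_deriv c1 hv (L x + c)).comp_hasFDerivAt x h1
  rw [show (fun x => prim c1 v (L x + c)) = prim c1 v ∘ (fun x => L x + c) from rfl, h2.fderiv]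
  simp

lemma test_bound {φ : E2 → ℝ} (h1 : ContDiff ℝ (⊤ : ℕ∞) φ) (h2 : HasCompactSupport φ) (v : E2) :
    Continuous φ ∧ Continuous (fun x => fderiv ℝ φ x v) ∧
    ∃ B, 0 ≤ B ∧ (∀ x, |φ x| ≤ B) ∧ ∀ x, |fderiv ℝ φ x v| ≤ B := by
  have hc := h1.continuous
  have hc' : Continuous (fun x => fderiv ℝ φ x v) :=
    (h1.continuous_fderiv (by simp)).clm_apply continuous_const
  have hs : HasCompactSupport (fun x => fderiv ℝ φ x v) := h2.fderiv_apply ℝ v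
  obtain ⟨B1, hB1⟩ := h2.exists_bound_of_continuous hc
  obtain ⟨B2, hB2⟩ := hs.exists_bound_of_continuous hc'
  refine ⟨hc, hc', max B1 B2, (norm_nonneg _).trans ((hB1 0).trans (le_max_left _ _)),
    fun x => (hB1 x).trans (le_max_left _ _), fun x => (hB2 x).trans (le_max_right _ _)⟩

lemma hft_ridge {p : Fin 3 → E2} (hp : ccw p) {L : E2 →L[ℝ] ℝ} (hL : L ≠ 0) (c c1 : ℝ) {v : ℝ → ℝ}
    (hvm : Measurable v) (hv : Integrable v) :
    HasFaceTrace p (fun x => prim c1 v (L x + c)) (fun d x => v (L x + c) * L (stdb2 d))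
      (fun j t => prim c1 v (L (epar p j t) + c)) := by
  rw [hft_iff]
  intro φ h1 h2 d
  obtain ⟨hφc, hφ'c, B, hB0, hB1, hB2⟩ := test_bound h1 h2 (stdb2 d)
  obtain ⟨C, hC0, hC⟩ := l1_ridge p hL c
  have hℓ : Continuous fun x => L x + c := by fun_prop
  set V := (volume (tri p)).toReal
  set N := ∑ j : Fin 3, |Nv p j (stdb2 d)|
  set M := B * V + C * |L (stdb2 d)| * B + N * B
  have hM : 0 ≤ M := by positivity
  have key : ∀ ε > 0, |(∫ x in tri p, (prim c1 v (L x + c) * fderiv ℝ φ x (stdb2 d) + v (L x + c) * L (stdb2 d) * φ x))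
      - ∑ j : Fin 3, Nv p j (stdb2 d) * ∫ t in Ioo (0:ℝ) 1, prim c1 v (L (epar p j t) + c) * φ (epar p j t)| ≤ ε * M := by
    intro ε hε
    obtain ⟨w, hws, hwε, hwc, hwi⟩ := hv.exists_hasCompactSupport_integral_sub_le hε
    have hE := (hft_iff _ _ _ _).1 (hft_ridge_C1 hp L c c1 hwc) φ h1 h2 d
    have hd : ∀ t, |prim c1 v t - prim c1 w t| ≤ ε := fun t => (prim_diff c1 hv hwi t).trans hwε
    have hkc := prim_cont c1 hv
    have hkwc := prim_cont c1 hwi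
    obtain ⟨hi, hb⟩ := hC (fun t => v t - w t) (hvm.sub hwc.measurable) (hv.sub hwi)
    have hvi := (hC v hvm hv).1
    have hbdd : ∀ {F : E2 → ℝ}, IntegrableOn F (tri p) → IntegrableOn (fun x => F x * L (stdb2 d) * φ x) (tri p) := by
      intro F hF
      refine (hF.mul_const _).mul_bdd (c := B) hφc.aestronglyMeasurable ?_
      exact Filter.Eventually.of_forall fun x => hB1 x
    have i1 : IntegrableOn (fun x => prim c1 v (L x + c) * fderiv ℝ φ x (stdb2 d)) (tri p) :=
      intT p ((hkc.comp hℓ).mul hφ'c)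
    have i2 : IntegrableOn (fun x => prim c1 w (L x + c) * fderiv ℝ φ x (stdb2 d)) (tri p) :=
      intT p ((hkwc.comp hℓ).mul hφ'c)
    have i3 := hbdd hvi
    have i4 := hbdd (hC w hwc.measurable hwi).1
    have e1 : |(∫ x in tri p, (prim c1 v (L x + c) * fderiv ℝ φ x (stdb2 d) + v (L x + c) * L (stdb2 d) * φ x))
      - ∫ x in tri p, (prim c1 w (L x + c) * fderiv ℝ φ x (stdb2 d) + w (L x + c) * L (stdb2 d) * φ x)|
        ≤ ε * (B * V) + ε * (C * |L (stdb2 d)| * B) := by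
      rw [integral_add i1 i3, integral_add i2 i4, add_sub_add_comm, ← integral_sub i1 i2, ← integral_sub i3 i4]
      refine (abs_add_le _ _).trans (add_le_add ?_ ?_)
      · have := norm_setIntegral_le_of_norm_le_const (μ := volume) (s := tri p) (C := ε * B) (tri_fin p)
          (f := fun x => prim c1 v (L x + c) * fderiv ℝ φ x (stdb2 d) - prim c1 w (L x + c) * fderiv ℝ φ x (stdb2 d)) ?_
        · rw [Real.norm_eq_abs] at this
          refine this.trans (le_of_eq ?_); simp [Measure.real, V]; ring
        · intro x _
          rw [← sub_mul, norm_mul]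
          exact mul_le_mul (hd _) (hB2 x) (norm_nonneg _) hε.le
      · rw [← Real.norm_eq_abs]
        refine (norm_integral_le_integral_norm _).trans ?_
        have : ∀ x, ‖v (L x + c) * L (stdb2 d) * φ x - w (L x + c) * L (stdb2 d) * φ x‖
            ≤ (|L (stdb2 d)| * B) * ‖v (L x + c) - w (L x + c)‖ := by
          intro x
          rw [← sub_mul, ← sub_mul, norm_mul, norm_mul, Real.norm_eq_abs (L _)]
          have := mul_le_mul_of_nonneg_left (hB1 x) (mul_nonneg (norm_nonneg (v (L x + c) - w (L x + c))) (abs_nonneg (L (stdb2 d))))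
          rw [Real.norm_eq_abs (φ x)]
          linarith
        refine (integral_mono (i3.sub i4).norm (hi.norm.const_mul _) this).trans ?_
        rw [integral_const_mul]
        have h4 : ∫ x in tri p, ‖v (L x + c) - w (L x + c)‖ ≤ C * ε :=
          hb.trans (mul_le_mul_of_nonneg_left hwε hC0)
        have h5 := mul_le_mul_of_nonneg_left h4 (mul_nonneg (abs_nonneg (L (stdb2 d))) hB0)
        linarith
    have e2 : |(∑ j : Fin 3, Nv p j (stdb2 d) * ∫ t in Ioo (0:ℝ) 1, prim c1 v (L (epar p j t) + c) * φ (epar p j t))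
      - ∑ j : Fin 3, Nv p j (stdb2 d) * ∫ t in Ioo (0:ℝ) 1, prim c1 w (L (epar p j t) + c) * φ (epar p j t)| ≤ ε * (N * B) := by
      rw [← Finset.sum_sub_distrib]
      refine (Finset.abs_sum_le_sum_abs _ _).trans ?_
      have : ε * (N * B) = ∑ j : Fin 3, |Nv p j (stdb2 d)| * (ε * B) := by
        rw [← Finset.sum_mul]; ring
      rw [this]
      refine Finset.sum_le_sum fun j _ => ?_
      rw [← mul_sub, abs_mul]
      refine mul_le_mul_of_nonneg_left ?_ (abs_nonneg _)
      have hpc := epar_cont p j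
      have j1 : IntegrableOn (fun t => prim c1 v (L (epar p j t) + c) * φ (epar p j t)) (Ioo (0:ℝ) 1) :=
        intI ((hkc.comp (hℓ.comp hpc)).mul (hφc.comp hpc)).continuousOn
      have j2 : IntegrableOn (fun t => prim c1 w (L (epar p j t) + c) * φ (epar p j t)) (Ioo (0:ℝ) 1) :=
        intI ((hkwc.comp (hℓ.comp hpc)).mul (hφc.comp hpc)).continuousOn
      rw [← integral_sub j1 j2]
      have := norm_setIntegral_le_of_norm_le_const (μ := volume) (s := Ioo (0:ℝ) 1) (C := ε * B) (by simp)
          (f := fun t => prim c1 v (L (epar p j t) + c) * φ (epar p j t) - prim c1 w (L (epar p j t) + c) * φ (epar p j t)) ?_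
      · simpa using this
      · intro x _
        rw [← sub_mul, norm_mul]
        exact mul_le_mul (hd _) (hB1 _) (norm_nonneg _) hε.le
    rw [← hE] at e2
    rw [abs_le] at *
    constructor <;> simp only [M] <;> linarith [e1.1, e1.2, e2.1, e2.2]
  by_contra hne
  have hpos := abs_pos.2 (sub_ne_zero.2 hne)
  set q := |(∫ x in tri p, (prim c1 v (L x + c) * fderiv ℝ φ x (stdb2 d) + v (L x + c) * L (stdb2 d) * φ x))
      - ∑ j : Fin 3, Nv p j (stdb2 d) * ∫ t in Ioo (0:ℝ) 1, prim c1 v (L (epar p j t) + c) * φ (epar p j t)|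
  have := key (q / (2 * (M + 1))) (by positivity)
  have h3 : q / (2 * (M + 1)) * M < q := by
    rw [div_mul_eq_mul_div, div_lt_iff₀ (by positivity)]
    nlinarith
  linarith

lemma l2mul {p : Fin 3 → E2} {F φ : E2 → ℝ} (hF : L2on (tri p) F) (hφ : Continuous φ) :
    IntegrableOn (fun x => F x * φ x) (tri p) :=
  MemLp.integrable_mul hF (l2T p hφ)

lemma l2_cmul {p : Fin 3 → E2} {F φ : E2 → ℝ} (hF : L2on (tri p) F) (hφ : Continuous φ) :
    L2on (tri p) (fun x => φ x * F x) := by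
  obtain ⟨C, hC⟩ := (hull_compact p).exists_bound_of_continuousOn hφ.continuousOn
  refine MemLp.mono' (g := fun x => |C| * ‖F x‖) (hF.norm.const_mul _)
    (hφ.aestronglyMeasurable.mul hF.1) ?_
  filter_upwards [ae_restrict_mem (tri_meas p)] with x hx
  rw [norm_mul]
  exact mul_le_mul_of_nonneg_right ((hC x (tri_sub p hx)).trans (le_abs_self _)) (norm_nonneg _)

lemma hft_add {p : Fin 3 → E2} {u u' : E2 → ℝ} {D D' : Fin 2 → E2 → ℝ} {b b' : Fin 3 → ℝ → ℝ}
    (h : HasFaceTrace p u D b) (h' : HasFaceTrace p u' D' b')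
    (hu : L2on (tri p) u) (hu' : L2on (tri p) u') (hD : ∀ d, L2on (tri p) (D d))
    (hD' : ∀ d, L2on (tri p) (D' d)) (hb : ∀ j, ContinuousOn (b j) (Icc 0 1))
    (hb' : ∀ j, ContinuousOn (b' j) (Icc 0 1)) :
    HasFaceTrace p (fun x => u x + u' x) (fun d x => D d x + D' d x) (fun j t => b j t + b' j t) := by
  rw [hft_iff] at *
  intro φ h1 h2 d
  obtain ⟨hφc, hφ'c, -⟩ := test_bound h1 h2 (stdb2 d)
  have e1 := h φ h1 h2 d
  have e2 := h' φ h1 h2 d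
  have i1 : IntegrableOn (fun x => u x * fderiv ℝ φ x (stdb2 d) + D d x * φ x) (tri p) :=
    (l2mul hu hφ'c).add (l2mul (hD d) hφc)
  have i2 : IntegrableOn (fun x => u' x * fderiv ℝ φ x (stdb2 d) + D' d x * φ x) (tri p) :=
    (l2mul hu' hφ'c).add (l2mul (hD' d) hφc)
  have e3 := integral_add i1 i2
  rw [e1, e2] at e3
  rw [← Finset.sum_add_distrib] at e3
  calc _ = _ := by congr 1; ext x; ring
    _ = _ := e3
    _ = _ := by
      refine Finset.sum_congr rfl fun j _ => ?_
      have hc : ContinuousOn (fun t => φ (epar p j t)) (Icc 0 1) := (hφc.comp (epar_cont p j)).continuousOn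
      have k1 : IntegrableOn (fun t => b j t * φ (epar p j t)) (Ioo (0:ℝ) 1) := intI ((hb j).mul hc)
      have k2 : IntegrableOn (fun t => b' j t * φ (epar p j t)) (Ioo (0:ℝ) 1) := intI ((hb' j).mul hc)
      rw [← mul_add, ← integral_add k1 k2]
      congr 2; ext x; ring

lemma hft_mul {p : Fin 3 → E2} {u θ : E2 → ℝ} {D : Fin 2 → E2 → ℝ} {b : Fin 3 → ℝ → ℝ}
    (h : HasFaceTrace p u D b) (hθ : ContDiff ℝ (⊤ : ℕ∞) θ) :
    HasFaceTrace p (fun x => θ x * u x) (fun d x => θ x * D d x + fderiv ℝ θ x (stdb2 d) * u x)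
      (fun j t => θ (epar p j t) * b j t) := by
  rw [hft_iff] at *
  intro φ h1 h2 d
  have e := h (fun x => θ x * φ x) (hθ.mul h1) (h2.mul_left) d
  calc _ = _ := by
        congr 1; ext x
        rw [fderiv_fun_mul (hθ.differentiable (by simp) x) (h1.differentiable (by simp) x)]
        simp
        ring
    _ = _ := e
    _ = _ := by
      refine Finset.sum_congr rfl fun j _ => ?_
      congr 2; ext x; ring

lemma hft_cmul {p : Fin 3 → E2} {u : E2 → ℝ} {D : Fin 2 → E2 → ℝ} {b : Fin 3 → ℝ → ℝ}
    (h : HasFaceTrace p u D b) (c : ℝ) :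
    HasFaceTrace p (fun x => c * u x) (fun d x => c * D d x) (fun j t => c * b j t) := by
  simpa using hft_mul (θ := fun _ => c) h contDiff_const

lemma hft_congr {p : Fin 3 → E2} {u : E2 → ℝ} {D : Fin 2 → E2 → ℝ} {b b' : Fin 3 → ℝ → ℝ}
    (h : HasFaceTrace p u D b) (hb : ∀ j, ∀ t ∈ Icc (0:ℝ) 1, b j t = b' j t) :
    HasFaceTrace p u D b' := by
  rw [hft_iff] at *
  intro φ h1 h2 d
  rw [h φ h1 h2 d]
  refine Finset.sum_congr rfl fun j _ => ?_
  congr 1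
  refine setIntegral_congr_fun measurableSet_Ioo fun t ht => ?_
  simp only [hb j t (Ioo_subset_Icc_self ht)]

/-- `C¹` functions with `L²` second weak derivatives together with their boundary traces -/
structure C1Lift (p : Fin 3 → E2) (ξ : E2 → ℝ) (G : Fin 2 → E2 → ℝ) (Hs : Fin 2 → Fin 2 → E2 → ℝ) : Prop where
  cξ : Continuous ξ
  cG : ∀ d, Continuous (G d)
  lH : ∀ d d', L2on (tri p) (Hs d d')
  t0 : HasFaceTrace p ξ G (fun j t => ξ (epar p j t))
  t1 : ∀ d, HasFaceTrace p (G d) (Hs d) (fun j t => G d (epar p j t))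

lemma C1Lift.add {p : Fin 3 → E2} {ξ ξ' : E2 → ℝ} {G G' : Fin 2 → E2 → ℝ} {Hs Hs' : Fin 2 → Fin 2 → E2 → ℝ}
    (h : C1Lift p ξ G Hs) (h' : C1Lift p ξ' G' Hs') :
    C1Lift p (fun x => ξ x + ξ' x) (fun d x => G d x + G' d x) (fun d d' x => Hs d d' x + Hs' d d' x) where
  cξ := h.cξ.add h'.cξ
  cG d := (h.cG d).add (h'.cG d)
  lH d d' := (h.lH d d').add (h'.lH d d')
  t0 := hft_add h.t0 h'.t0 (l2T p h.cξ) (l2T p h'.cξ) (fun d => l2T p (h.cG d)) (fun d => l2T p (h'.cG d))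
    (fun j => (h.cξ.comp (epar_cont p j)).continuousOn) (fun j => (h'.cξ.comp (epar_cont p j)).continuousOn)
  t1 d := hft_add (h.t1 d) (h'.t1 d) (l2T p (h.cG d)) (l2T p (h'.cG d)) (h.lH d) (h'.lH d)
    (fun j => ((h.cG d).comp (epar_cont p j)).continuousOn) (fun j => ((h'.cG d).comp (epar_cont p j)).continuousOn)

lemma C1Lift.smul {p : Fin 3 → E2} {ξ θ : E2 → ℝ} {G : Fin 2 → E2 → ℝ} {Hs : Fin 2 → Fin 2 → E2 → ℝ}
    (h : C1Lift p ξ G Hs) (hθ : ContDiff ℝ (⊤ : ℕ∞) θ) :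
    C1Lift p (fun x => θ x * ξ x) (fun d x => θ x * G d x + fderiv ℝ θ x (stdb2 d) * ξ x)
      (fun d d' x => (θ x * Hs d d' x + fderiv ℝ θ x (stdb2 d') * G d x) +
        (fderiv ℝ θ x (stdb2 d) * G d' x + fderiv ℝ (fun y => fderiv ℝ θ y (stdb2 d)) x (stdb2 d') * ξ x)) := by
  have cθ := hθ.continuous
  have sθ : ∀ d, ContDiff ℝ (⊤ : ℕ∞) (fun x => fderiv ℝ θ x (stdb2 d)) := fun d =>
    (hθ.fderiv_right (m := (⊤ : ℕ∞)) (by simp)).clm_apply contDiff_const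
  have cθ' : ∀ d, Continuous (fun x => fderiv ℝ θ x (stdb2 d)) := fun d => (sθ d).continuous
  have cθ'' : ∀ d d', Continuous (fun x => fderiv ℝ (fun y => fderiv ℝ θ y (stdb2 d)) x (stdb2 d')) := fun d d' =>
    ((sθ d).continuous_fderiv (by simp)).clm_apply continuous_const
  have l1 : ∀ d d', L2on (tri p) (fun x => θ x * Hs d d' x + fderiv ℝ θ x (stdb2 d') * G d x) := fun d d' =>
    (l2_cmul (h.lH d d') cθ).add (l2T p ((cθ' d').mul (h.cG d)))
  have l2 : ∀ d d', L2on (tri p) (fun x => fderiv ℝ θ x (stdb2 d) * G d' x + fderiv ℝ (fun y => fderiv ℝ θ y (stdb2 d)) x (stdb2 d') * ξ x) :=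
    fun d d' => l2T p (((cθ' d).mul (h.cG d')).add ((cθ'' d d').mul h.cξ))
  refine ⟨cθ.mul h.cξ, fun d => (cθ.mul (h.cG d)).add ((cθ' d).mul h.cξ), fun d d' => (l1 d d').add (l2 d d'), hft_mul h.t0 hθ, fun d => ?_⟩
  exact hft_add (hft_mul (h.t1 d) hθ) (hft_mul h.t0 (sθ d)) (l2T p (cθ.mul (h.cG d))) (l2T p ((cθ' d).mul h.cξ))
    (l1 d) (l2 d) (fun j => ((cθ.mul (h.cG d)).comp (epar_cont p j)).continuousOn)
    (fun j => (((cθ' d).mul h.cξ).comp (epar_cont p j)).continuousOn)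

lemma C1Lift.ridge {p : Fin 3 → E2} (hp : ccw p) {L : E2 →L[ℝ] ℝ} (hL : L ≠ 0) (c c0 c1 : ℝ) {v : ℝ → ℝ}
    (hvm : Measurable v) (hv : Integrable v) (hv2 : MemLp v 2 volume) :
    C1Lift p (fun x => prim c0 (prim c1 v) (L x + c)) (fun d x => prim c1 v (L x + c) * L (stdb2 d))
      (fun d d' x => v (L x + c) * L (stdb2 d') * L (stdb2 d)) := by
  have hℓ : Continuous fun x => L x + c := by fun_prop
  have hk := prim_cont c1 hv
  refine ⟨((prim_C1 c0 hk).continuous).comp hℓ, fun d => (hk.comp hℓ).mul continuous_const,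
    fun d d' => ?_, hft_ridge_C1 hp L c c0 hk, fun d => ?_⟩
  · have := ((memLp_ridge p hL c hvm hv2).const_mul (L (stdb2 d'))).const_mul (L (stdb2 d))
    refine this.ae_eq (Filter.Eventually.of_forall fun x => ?_)
    simp; ring
  · have := hft_cmul (hft_ridge hp hL c c1 hvm hv) (L (stdb2 d))
    convert this using 1
    · ext x; ring
    · ext d' x; ring
    · ext j t; ring

lemma epar_frontier {p : Fin 3 → E2} (hp : ccw p) (j : Fin 3) {t : ℝ} (ht : t ∈ Icc (0:ℝ) 1) :
    epar p j t ∉ tri p := by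
  intro hmem
  -- linear functional vanishing on the edge, nonnegative on hull
  let N : E2 → ℝ := fun x => evec p j 0 * (x - p (j+1)) 1 - evec p j 1 * (x - p (j+1)) 0
  have hDt : 0 < Dt p := hp
  have hull : ∀ x ∈ convexHull ℝ (range p), 0 ≤ N x := by
    intro x hx
    rw [hull_eq] at hx
    obtain ⟨y, ⟨h0, h1, h2⟩, rfl⟩ := hx
    have : N (Psi p y) = Dt p * (if j = 0 then 1 - y 0 - y 1 else if j = 1 then y 0 else y 1) := by
      fin_cases j <;> simp [N, Psi, evec, Dt] <;> ring
    rw [this]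
    apply mul_nonneg hDt.le
    split_ifs <;> linarith
  have hN0 : N (epar p j t) = 0 := by simp [N, epar]; ring
  -- move in direction with N negative
  have hn := (tri_open p).mem_nhds hmem
  let w : E2 := !₂[evec p j 1, -evec p j 0]
  have hcont : Filter.Tendsto (fun s : ℝ => epar p j t + s • w) (nhds 0) (nhds (epar p j t)) := by
    have : Continuous (fun s : ℝ => epar p j t + s • w) := by fun_prop
    simpa using this.tendsto 0
  have hev := (hcont.eventually hn)
  have hev2 : ∀ᶠ s in nhdsWithin (0:ℝ) (Ioi 0), epar p j t + s • w ∈ tri p := hev.filter_mono nhdsWithin_le_nhds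
  obtain ⟨s, hs1, hs2⟩ := (hev2.and self_mem_nhdsWithin).exists
  have h1 := hull _ (tri_sub p hs1)
  have h2 : N (epar p j t + s • w) = - s * (evec p j 0 ^ 2 + evec p j 1 ^ 2) := by
    simp [N, epar, w]; ring
  have h3 : 0 < evec p j 0 ^ 2 + evec p j 1 ^ 2 := by
    by_contra hcon
    have a0 : evec p j 0 = 0 := by nlinarith [sq_nonneg (evec p j 0), sq_nonneg (evec p j 1)]
    have a1 : evec p j 1 = 0 := by nlinarith [sq_nonneg (evec p j 0), sq_nonneg (evec p j 1)]
    have : Dt p = 0 := by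
      fin_cases j <;> simp [evec] at a0 a1 <;> simp [Dt] <;> 
        [skip; skip; skip] <;> [
          rw [sub_eq_zero.1 a0, sub_eq_zero.1 a1]; rw [sub_eq_zero.1 a0, sub_eq_zero.1 a1]; rw [sub_eq_zero.1 a0, sub_eq_zero.1 a1]] <;> ring
    linarith
  rw [h2] at h1
  have : (0:ℝ) < s := hs2
  nlinarith

lemma hft_weak {p : Fin 3 → E2} (hp : ccw p) {u : E2 → ℝ} {D : Fin 2 → E2 → ℝ} {b : Fin 3 → ℝ → ℝ}
    (h : HasFaceTrace p u D b) (hu : L2on (tri p) u) (hD : ∀ d, L2on (tri p) (D d)) (d : Fin 2) :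
    IsWeakD (tri p) u (D d) (EuclideanSpace.single d 1) := by
  rw [hft_iff] at h
  intro φ h1 h2 h3
  obtain ⟨hφc, hφ'c, -⟩ := test_bound h1 h2 (stdb2 d)
  have e := h φ h1 h2 d
  rw [integral_add (l2mul hu hφ'c) (l2mul (hD d) hφc)] at e
  have : ∀ j : Fin 3, ∫ t in Ioo (0:ℝ) 1, b j t * φ (epar p j t) = 0 := by
    intro j
    refine setIntegral_eq_zero_of_forall_eq_zero fun t ht => ?_
    rw [image_eq_zero_of_notMem_tsupport (fun hx => epar_frontier hp j (Ioo_subset_Icc_self ht) (h3 hx)), mul_zero]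
  simp only [this, mul_zero, Finset.sum_const_zero] at e
  exact eq_neg_of_add_eq_zero_left e

lemma hft_memH2W {p : Fin 3 → E2} (hp : ccw p) {ξ : E2 → ℝ} {G : Fin 2 → E2 → ℝ} {Hs : Fin 2 → Fin 2 → E2 → ℝ}
    {b : Fin 3 → ℝ → ℝ} {b' : Fin 2 → Fin 3 → ℝ → ℝ}
    (lξ : L2on (tri p) ξ) (lG : ∀ d, L2on (tri p) (G d)) (lH : ∀ d d', L2on (tri p) (Hs d d'))
    (t0 : HasFaceTrace p ξ G b) (t1 : ∀ d, HasFaceTrace p (G d) (Hs d) (b' d)) :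
    MemH2W (tri p) ξ G Hs :=
  ⟨lξ, fun d => ⟨lG d, hft_weak hp t0 lξ lG d⟩, fun d d' => ⟨lH d d', hft_weak hp (t1 d) (lG d) (lH d) d'⟩⟩

lemma ii01 (F : ℝ → ℝ) : ∫ t in Ioo (0:ℝ) 1, F t = ∫ t in (0:ℝ)..1, F t := by
  rw [intervalIntegral.integral_of_le zero_le_one, integral_Ioc_eq_integral_Ioo]

lemma smooth_prim {g : ℝ → ℝ} (hg : ContDiff ℝ (⊤ : ℕ∞) g) : ContDiff ℝ (⊤ : ℕ∞) (prim 0 g) := by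
  have h1 : deriv (prim 0 g) = g := funext fun t => (prim_deriv 0 hg.continuous t).deriv
  rw [contDiff_infty_iff_deriv, h1]
  exact ⟨fun t => (prim_deriv 0 hg.continuous t).differentiableAt, hg⟩

lemma test_prim {g : ℝ → ℝ} (hg : ContDiff ℝ (⊤ : ℕ∞) g) (hc : HasCompactSupport g)
    (hs : tsupport g ⊆ Ioo 0 1) (h0 : ∫ t in (0:ℝ)..1, g t = 0) :
    HasCompactSupport (prim 0 g) ∧ tsupport (prim 0 g) ⊆ Ioo 0 1 := by
  obtain ⟨a, b, ha, hb, hab⟩ : ∃ a b : ℝ, 0 < a ∧ b < 1 ∧ tsupport g ⊆ Icc a b := by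
    rcases (tsupport g).eq_empty_or_nonempty with he | hne
    · exact ⟨1/2, 1/2, by norm_num, by norm_num, by simp [he]⟩
    · obtain ⟨a, ha⟩ := IsCompact.exists_isLeast hc hne
      obtain ⟨b, hb⟩ := IsCompact.exists_isGreatest hc hne
      exact ⟨a, b, (hs ha.1).1, (hs hb.1).2, fun x hx => ⟨ha.2 hx, hb.2 hx⟩⟩
  have hz : ∀ x, x ∉ Icc a b → g x = 0 := fun x hx =>
    image_eq_zero_of_notMem_tsupport fun h => hx (hab h)
  have hsup : Function.support (prim 0 g) ⊆ Icc a b := by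
    intro x hx
    by_contra hxn
    apply hx
    simp only [prim, zero_add]
    have hii : ∀ s t : ℝ, IntervalIntegrable g volume s t := fun s t => hg.continuous.intervalIntegrable _ _
    by_cases hxa : x < a
    · refine intervalIntegral.integral_zero_ae (Filter.Eventually.of_forall fun t ht => hz t fun h => ?_)
      have := uIoc_subset_uIcc ht
      rw [mem_uIcc] at this
      rcases this with h1 | h1 <;> linarith [h.1]
    · have hxb : b < x := by
        by_contra hh
        exact hxn ⟨not_lt.1 hxa, not_lt.1 hh⟩
      rw [← intervalIntegral.integral_add_adjacent_intervals (hii 0 1) (hii 1 x), h0, zero_add]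
      refine intervalIntegral.integral_zero_ae (Filter.Eventually.of_forall fun t ht => hz t fun h => ?_)
      have := uIoc_subset_uIcc ht
      rw [mem_uIcc] at this
      rcases this with h1 | h1 <;> linarith [h.2]
  have ht : tsupport (prim 0 g) ⊆ Icc a b := closure_minimal hsup isClosed_Icc
  exact ⟨isCompact_Icc.of_isClosed_subset (isClosed_tsupport _) ht,
    ht.trans fun x hx => ⟨ha.trans_le hx.1, hx.2.trans_lt hb⟩⟩

lemma dubois {z : ℝ → ℝ} (hz : IntegrableOn z (Ioo 0 1))
    (h : ∀ φ : ℝ → ℝ, ContDiff ℝ (⊤ : ℕ∞) φ → HasCompactSupport φ → tsupport φ ⊆ Ioo 0 1 →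
      ∫ t in Ioo (0:ℝ) 1, z t * deriv φ t = 0) :
    ∃ c, ∀ᵐ t, t ∈ Ioo (0:ℝ) 1 → z t = c := by
  let B : ContDiffBump (1/2 : ℝ) := ⟨1/8, 1/4, by norm_num, by norm_num⟩
  let η : ℝ → ℝ := B.normed volume
  have hηs : ContDiff ℝ (⊤ : ℕ∞) η := B.contDiff_normed
  have hηc : HasCompactSupport η := B.hasCompactSupport_normed
  have hηt : tsupport η ⊆ Ioo 0 1 := by
    rw [B.tsupport_normed_eq]
    intro x hx
    rw [Metric.mem_closedBall, Real.dist_eq] at hx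
    have := abs_le.1 hx
    simp only [B] at this
    constructor <;> linarith [this.1, this.2]
  have toIoo : ∀ {g : ℝ → ℝ}, tsupport g ⊆ Ioo 0 1 → ∀ k : ℝ → ℝ, ∫ t, g t * k t = ∫ t in Ioo (0:ℝ) 1, g t * k t := by
    intro g hg k
    symm
    apply setIntegral_eq_integral_of_forall_compl_eq_zero
    intro t ht
    rw [image_eq_zero_of_notMem_tsupport (fun h => ht (hg h)), zero_mul]
  have hη1 : ∫ t in (0:ℝ)..1, η t = 1 := by
    rw [← ii01]
    have := toIoo hηt (fun _ => 1)
    simp only [mul_one] at this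
    rw [← this]; exact B.integral_normed
  have bdd : ∀ {g : ℝ → ℝ}, Continuous g → IntegrableOn (fun t => z t * g t) (Ioo 0 1) := by
    intro g hg
    obtain ⟨C, hC⟩ := isCompact_Icc.exists_bound_of_continuousOn (hg.continuousOn (s := Icc (0:ℝ) 1))
    refine hz.mul_bdd (c := C) hg.aestronglyMeasurable ?_
    filter_upwards [ae_restrict_mem measurableSet_Ioo] with t ht
    exact hC t (Ioo_subset_Icc_self ht)
  set c := ∫ t in Ioo (0:ℝ) 1, z t * η t with hc
  refine ⟨c, ?_⟩
  have := isOpen_Ioo.ae_eq_zero_of_integral_contDiff_smul_eq_zero (U := Ioo (0:ℝ) 1) (μ := volume) (f := fun t => z t - c) ?_ ?_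
  · filter_upwards [this] with t ht h
    linarith [ht h]
  · exact (hz.sub (integrableOn_const (by simp))).locallyIntegrableOn
  · intro ψ hψ hψc hψt
    simp only [smul_eq_mul]
    rw [toIoo hψt]
    set m := ∫ t in (0:ℝ)..1, ψ t with hm
    let g : ℝ → ℝ := fun t => ψ t - m * η t
    have hgs : ContDiff ℝ (⊤ : ℕ∞) g := hψ.sub (contDiff_const.mul hηs)
    have hgt : tsupport g ⊆ tsupport ψ ∪ tsupport η := by
      refine closure_minimal ?_ ((isClosed_tsupport _).union (isClosed_tsupport _))
      intro t ht
      by_contra hn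
      rw [mem_union, not_or] at hn
      apply ht
      simp [g, image_eq_zero_of_notMem_tsupport hn.1, image_eq_zero_of_notMem_tsupport hn.2]
    have hgc : HasCompactSupport g := (IsCompact.union hψc hηc).of_isClosed_subset (isClosed_tsupport _) hgt
    have hg0 : ∫ t in (0:ℝ)..1, g t = 0 := by
      simp only [g]
      rw [intervalIntegral.integral_sub (hψ.continuous.intervalIntegrable _ _)
        ((hηs.continuous.const_mul m).intervalIntegrable _ _), intervalIntegral.integral_const_mul, hη1]
      simp [m]
    obtain ⟨k1, k2⟩ := test_prim hgs hgc (hgt.trans (union_subset hψt hηt)) hg0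
    have e := h _ (smooth_prim hgs) k1 k2
    rw [show deriv (prim 0 g) = g from funext fun t => (prim_deriv 0 hgs.continuous t).deriv] at e
    have e2 : ∫ t in Ioo (0:ℝ) 1, z t * g t = (∫ t in Ioo (0:ℝ) 1, z t * ψ t) - m * c := by
      rw [hc, ← integral_const_mul, ← integral_sub (bdd hψ.continuous) ((bdd hηs.continuous).const_mul m)]
      congr 1; ext t; simp only [g]; ring
    have e3 : ∫ t in Ioo (0:ℝ) 1, ψ t * (z t - c) = (∫ t in Ioo (0:ℝ) 1, z t * ψ t) - m * c := by
      rw [hm, ← ii01, ← integral_mul_const, ← integral_sub (bdd hψ.continuous)]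
      · congr 1; ext t; ring
      · exact (intI hψ.continuous.continuousOn).mul_const c
    rw [e3, ← e2, e]

/-- a continuous function on `[0,1]` with weak derivative in `L²` is the primitive of it -/
lemma weak1_prim {u v : ℝ → ℝ} (hu : ContinuousOn u (Icc 0 1))
    (hv : MemLp v 2 (volume.restrict (Ioo (0:ℝ) 1))) (h : IsWeakD1 (Ioo 0 1) u v) :
    ∃ w : ℝ → ℝ, Measurable w ∧ Integrable w ∧ MemLp w 2 volume ∧ (∀ t, t ∉ Ioo (0:ℝ) 1 → w t = 0) ∧
      ∀ t ∈ Icc (0:ℝ) 1, u t = prim (u 0) w t := by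
  let w : ℝ → ℝ := (Ioo (0:ℝ) 1).indicator (hv.1.mk v)
  have hwm : Measurable w := (hv.1.stronglyMeasurable_mk.measurable).indicator measurableSet_Ioo
  have hw2' : MemLp (hv.1.mk v) 2 (volume.restrict (Ioo (0:ℝ) 1)) := hv.ae_eq hv.1.ae_eq_mk
  have hw2 : MemLp w 2 volume := (memLp_indicator_iff_restrict measurableSet_Ioo).2 hw2'
  have hwi : Integrable w := (integrable_indicator_iff measurableSet_Ioo).2 (hw2'.integrable (by norm_num))
  have hvw : ∀ᵐ t ∂(volume.restrict (Ioo (0:ℝ) 1)), v t = w t := by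
    filter_upwards [hv.1.ae_eq_mk, ae_restrict_mem measurableSet_Ioo] with t h1 h2
    rw [h1]; simp [w, h2]
  refine ⟨w, hwm, hwi, hw2, fun t ht => by simp only [w, indicator_of_notMem ht], ?_⟩
  have hpc := prim_cont 0 hwi
  have hdb : ∀ φ : ℝ → ℝ, ContDiff ℝ (⊤ : ℕ∞) φ → HasCompactSupport φ → tsupport φ ⊆ Ioo 0 1 →
      ∫ t in Ioo (0:ℝ) 1, (u t - prim 0 w t) * deriv φ t = 0 := by
    intro φ h1 h2 h3
    have hφ0 : φ 0 = 0 := image_eq_zero_of_notMem_tsupport fun h => by simpa using h3 h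
    have hφ1 : φ 1 = 0 := image_eq_zero_of_notMem_tsupport fun h => by simpa using h3 h
    have hcd : Continuous (deriv φ) := h1.continuous_deriv (by simp)
    have e := AbsolutelyContinuousOnInterval.integral_mul_deriv_eq_deriv_mul (a := 0) (b := 1) (f := fun x => ∫ v in (0:ℝ)..x, w v) (g := φ)
      (hwi.intervalIntegrable.absolutelyContinuousOnInterval_intervalIntegral (by simp))
      (ContDiffOn.absolutelyContinuousOnInterval ((h1.of_le (by simp)).contDiffOn))
    rw [hφ0, hφ1] at e
    simp only [mul_zero, sub_zero, zero_sub] at e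
    have e1 : ∫ x in (0:ℝ)..1, deriv (fun x => ∫ v in (0:ℝ)..x, w v) x * φ x = ∫ t in Ioo (0:ℝ) 1, v t * φ t := by
      rw [← ii01]
      refine integral_congr_ae ?_
      filter_upwards [hvw, ae_restrict_of_ae (LocallyIntegrable.ae_hasDerivAt_integral hwi.locallyIntegrable)] with t h1 h2
      rw [(h2 0).deriv, h1]
    rw [e1, ← h φ h1 h2 h3, ← ii01] at e
    have i1 : IntegrableOn (fun t => u t * deriv φ t) (Ioo 0 1) := intI (hu.mul hcd.continuousOn)
    have i2 : IntegrableOn (fun t => prim 0 w t * deriv φ t) (Ioo 0 1) := intI (hpc.mul hcd).continuousOn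
    simp only [sub_mul]
    rw [integral_sub i1 i2, ← e]
    simp [prim]
  obtain ⟨c, hc⟩ := dubois (z := fun t => u t - prim 0 w t) ((intI hu).sub (intI hpc.continuousOn)) hdb
  have key : EqOn u (fun t => c + prim 0 w t) (Icc 0 1) := by
    apply Measure.eqOn_Icc_of_ae_eq volume (by norm_num) _ hu (hpc.const_add c).continuousOn
    rw [← restrict_Ioo_eq_restrict_Icc]
    refine (ae_restrict_iff' measurableSet_Ioo).2 ?_
    filter_upwards [hc] with t ht h
    linarith [ht h]
  have h0 := key (left_mem_Icc.2 zero_le_one)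
  simp [prim] at h0
  intro t ht
  rw [key ht, h0]; simp [prim]

lemma bdry_g {g : ℝ → ℝ} (h : MemHedge 1 g) (hc : ContinuousOn g (Icc 0 1)) :
    ∃ w : ℝ → ℝ, Measurable w ∧ Integrable w ∧ MemLp w 2 volume ∧ (∀ t, t ∉ Ioo (0:ℝ) 1 → w t = 0) ∧
      ∀ t ∈ Icc (0:ℝ) 1, g t = prim (g 0) w t := by
  obtain ⟨h1, v, h2, h3⟩ := h
  exact weak1_prim hc h3 h2

lemma bdry_f {f : ℝ → ℝ} (h : MemHedge 2 f) (hc : ContDiffOn ℝ 1 f (Icc 0 1)) :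
    (∃ w : ℝ → ℝ, Measurable w ∧ Integrable w ∧ MemLp w 2 volume ∧ (∀ t, t ∉ Ioo (0:ℝ) 1 → w t = 0) ∧
      ∀ t ∈ Icc (0:ℝ) 1, derivWithin f (Icc 0 1) t = prim (derivWithin f (Icc 0 1) 0) w t) ∧
    ∀ t ∈ Icc (0:ℝ) 1, f t = f 0 + ∫ s in (0:ℝ)..t, derivWithin f (Icc 0 1) s := by
  obtain ⟨h1, v, h2, h3, v2, h4, h5⟩ := h
  have hdc : ContinuousOn (derivWithin f (Icc 0 1)) (Icc 0 1) :=
    hc.continuousOn_derivWithin (uniqueDiffOn_Icc zero_lt_one) le_rfl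
  have hda : ∀ t ∈ Ioo (0:ℝ) 1, HasDerivAt f (derivWithin f (Icc 0 1) t) t := fun t ht =>
    ((hc.differentiableOn (by norm_num) t (Ioo_subset_Icc_self ht)).hasDerivWithinAt).hasDerivAt
      (Icc_mem_nhds ht.1 ht.2)
  constructor
  · have hae : ∀ᵐ t, t ∈ Ioo (0:ℝ) 1 → v t - derivWithin f (Icc 0 1) t = 0 := by
      have iv : IntegrableOn v (Ioo 0 1) := h3.integrable (by norm_num)
      apply isOpen_Ioo.ae_eq_zero_of_integral_contDiff_smul_eq_zero
      · exact (iv.sub (intI hdc)).locallyIntegrableOn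
      · intro φ k1 k2 k3
        have hφ0 : φ 0 = 0 := image_eq_zero_of_notMem_tsupport fun h => by simpa using k3 h
        have hφ1 : φ 1 = 0 := image_eq_zero_of_notMem_tsupport fun h => by simpa using k3 h
        rw [← setIntegral_eq_integral_of_forall_compl_eq_zero (s := Ioo 0 1)]
        · have e := h2 φ k1 k2 k3
          have e2 := AbsolutelyContinuousOnInterval.integral_mul_deriv_eq_deriv_mul (a := 0) (b := 1) (f := f) (g := φ)
            (ContDiffOn.absolutelyContinuousOnInterval (by rwa [uIcc_of_le zero_le_one]))
            (ContDiffOn.absolutelyContinuousOnInterval ((k1.of_le (by simp)).contDiffOn))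
          rw [hφ0, hφ1, ← ii01, ← ii01, e] at e2
          simp only [mul_zero, sub_zero, zero_sub, neg_inj] at e2
          have e3 : ∫ t in Ioo (0:ℝ) 1, deriv f t * φ t = ∫ t in Ioo (0:ℝ) 1, derivWithin f (Icc 0 1) t * φ t :=
            setIntegral_congr_fun measurableSet_Ioo fun t ht => by simp only [(hda t ht).deriv]
          rw [e3] at e2
          have j1 : IntegrableOn (fun t => v t * φ t) (Ioo 0 1) := by
            obtain ⟨C, hC⟩ := k2.exists_bound_of_continuous k1.continuous
            exact iv.mul_bdd (c := C) k1.continuous.aestronglyMeasurable (Filter.Eventually.of_forall hC)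
          have j2 : IntegrableOn (fun t => derivWithin f (Icc 0 1) t * φ t) (Ioo 0 1) := intI (hdc.mul k1.continuous.continuousOn)
          have := integral_sub j1 j2
          rw [e2, sub_self] at this
          refine Eq.trans ?_ this
          congr 1; ext t; simp only [smul_eq_mul]; ring
        · intro t ht
          rw [image_eq_zero_of_notMem_tsupport (fun h => ht (k3 h)), zero_smul]
    refine weak1_prim hdc h5 ?_
    intro φ k1 k2 k3
    rw [← h4 φ k1 k2 k3]
    refine integral_congr_ae ?_
    filter_upwards [ae_restrict_of_ae hae, ae_restrict_mem measurableSet_Ioo] with t q1 q2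
    have := q1 q2
    rw [show v t = derivWithin f (Icc 0 1) t by linarith]
  · intro t ht
    have hsub : Icc 0 t ⊆ Icc (0:ℝ) 1 := Icc_subset_Icc_right ht.2
    rw [intervalIntegral.integral_eq_sub_of_hasDerivAt_of_le ht.1 (hc.continuousOn.mono hsub)
      (fun x hx => hda x ⟨hx.1, hx.2.trans_le ht.2⟩)]
    · ring
    · apply ContinuousOn.intervalIntegrable
      rw [uIcc_of_le ht.1]; exact hdc.mono hsub

/-- admissible second derivatives along an edge -/
structure Nice (v : ℝ → ℝ) : Prop where
  m : Measurable v
  i : Integrable v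
  l : MemLp v 2 volume
  z : ∀ t, t ∉ Ioo (0:ℝ) 1 → v t = 0

lemma Nice.lin {v w : ℝ → ℝ} (hv : Nice v) (hw : Nice w) (a b : ℝ) : Nice (fun t => a * v t + b * w t) where
  m := (hv.m.const_mul a).add (hw.m.const_mul b)
  i := (hv.i.const_mul a).add (hw.i.const_mul b)
  l := (hv.l.const_mul a).add (hw.l.const_mul b)
  z t ht := by simp [hv.z t ht, hw.z t ht]

lemma Nice.refl {v : ℝ → ℝ} (hv : Nice v) : Nice (fun t => - v (1 - t)) where
  m := (hv.m.comp (measurable_const.sub measurable_id)).neg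
  i := (hv.i.comp_sub_left 1).neg
  l := (hv.l.comp_measurePreserving (Measure.measurePreserving_sub_left volume 1)).neg
  z t ht := by
    rw [hv.z (1 - t), neg_zero]
    intro h; apply ht
    constructor <;> linarith [h.1, h.2]

lemma prim_lin (c c' a b t : ℝ) {v w : ℝ → ℝ} (hv : Integrable v) (hw : Integrable w) :
    prim (a * c + b * c') (fun t => a * v t + b * w t) t = a * prim c v t + b * prim c' w t := by
  simp only [prim]
  rw [intervalIntegral.integral_add (hv.intervalIntegrable.const_mul a) (hw.intervalIntegrable.const_mul b),
    intervalIntegral.integral_const_mul, intervalIntegral.integral_const_mul]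
  ring

lemma prim_refl (c s : ℝ) {v : ℝ → ℝ} (hv : Integrable v) :
    prim c v (1 - s) = prim (prim c v 1) (fun t => - v (1 - t)) s := by
  have h := intervalIntegral.integral_comp_sub_left (a := 0) (b := s) v 1
  simp only [prim]
  rw [intervalIntegral.integral_neg, h, sub_zero]
  have := intervalIntegral.integral_add_adjacent_intervals (hv.intervalIntegrable (a := 0) (b := 1 - s)) (hv.intervalIntegrable (a := 1 - s) (b := 1))
  linarith

lemma vH_int {vβ vγ : ℝ → ℝ} (hβ : Nice vβ) (hγ : Nice vγ) {t : ℝ} (ht : 0 ≤ t) :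
    (∫ s in (0:ℝ)..t, -(vβ s + vγ (-s))) = - ∫ s in (0:ℝ)..t, vβ s ∧
    (∫ s in (0:ℝ)..(-t), -(vβ s + vγ (-s))) = ∫ s in (0:ℝ)..t, vγ s := by
  constructor
  · rw [intervalIntegral.integral_neg]
    congr 1
    refine intervalIntegral.integral_congr fun s hs => ?_
    rw [uIcc_of_le ht] at hs
    rw [hγ.z (-s) (fun h => by linarith [h.1, hs.1]), add_zero]
  · have h1 : ∫ s in (0:ℝ)..(-t), -(vβ s + vγ (-s)) = ∫ s in (0:ℝ)..(-t), -(vγ (-s)) := by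
      refine intervalIntegral.integral_congr fun s hs => ?_
      rw [uIcc_of_ge (by linarith)] at hs
      rw [hβ.z s (fun h => by linarith [h.1, hs.2]), zero_add]
    rw [h1, intervalIntegral.integral_neg, intervalIntegral.integral_comp_neg (f := vγ)]
    simp only [neg_neg, neg_zero]
    rw [intervalIntegral.integral_symm]; ring

lemma vH_nice {vβ vγ : ℝ → ℝ} (hβ : Nice vβ) (hγ : Nice vγ) :
    Measurable (fun s => -(vβ s + vγ (-s))) ∧ Integrable (fun s => -(vβ s + vγ (-s))) ∧
    MemLp (fun s => -(vβ s + vγ (-s))) 2 volume :=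
  ⟨(hβ.m.add (hγ.m.comp measurable_neg)).neg, (hβ.i.add hγ.i.comp_neg).neg,
    (hβ.l.add (hγ.l.comp_measurePreserving (Measure.measurePreserving_neg volume))).neg⟩

/-- lifting near a vertex -/
lemma vertex_lift {p : Fin 3 → E2} (hp : ccw p) {L M : E2 →L[ℝ] ℝ} (hL : L ≠ 0) (hM : M ≠ 0) (hLM : L - M ≠ 0)
    (cL cM c0 α0 β0 : ℝ) {vα vβ vγ vδ : ℝ → ℝ} (hα : Nice vα) (hβ : Nice vβ) (hγ : Nice vγ) (hδ : Nice vδ) :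
    ∃ ζ G Hs, C1Lift p ζ G Hs ∧
      (∀ x, M x + cM = 0 → ∀ t, L x + cL = t → 0 ≤ t →
        ζ x = prim c0 (prim α0 vα) t ∧ ∀ d, G d x = prim α0 vα t * L (stdb2 d) + prim β0 vβ t * M (stdb2 d)) ∧
      (∀ x, L x + cL = 0 → ∀ t, M x + cM = t → 0 ≤ t →
        ζ x = prim c0 (prim β0 vδ) t ∧ ∀ d, G d x = prim α0 vγ t * L (stdb2 d) + prim β0 vδ t * M (stdb2 d)) := by
  have n1 := hα.lin hβ 1 1
  have n2 := hδ.lin hγ 1 1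
  obtain ⟨m3, i3, l3⟩ := vH_nice hβ hγ
  set vH : ℝ → ℝ := fun s => -(vβ s + vγ (-s)) with hvH
  have r1 := C1Lift.ridge hp hL cL c0 α0 n1.m n1.i n1.l
  have r2 := C1Lift.ridge hp hM cM 0 β0 n2.m n2.i n2.l
  have r3 := C1Lift.ridge hp hLM (cL - cM) 0 0 m3 i3 l3
  have P : ∀ t, 0 ≤ t → prim 0 vH t = - (prim 0 vβ t) ∧ prim 0 vH (-t) = prim 0 vγ t := by
    intro t ht
    obtain ⟨a1, a2⟩ := vH_int hβ hγ ht
    exact ⟨by simp only [prim, hvH, a1, zero_add], by simp only [prim, hvH, a2, zero_add]⟩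
  have P1 : ∀ t, prim α0 (fun t => 1 * vα t + 1 * vβ t) t = prim α0 vα t + prim 0 vβ t := by
    intro t
    have := prim_lin α0 0 1 1 t hα.i hβ.i
    simpa using this
  have P2 : ∀ t, prim β0 (fun t => 1 * vδ t + 1 * vγ t) t = prim β0 vδ t + prim 0 vγ t := by
    intro t
    have := prim_lin β0 0 1 1 t hδ.i hγ.i
    simpa using this
  have sh : ∀ c v t, prim c v t = c + prim 0 v t := by intro c v t; simp [prim]
  have z0 : ∀ c v, prim c v 0 = c := by intro c v; simp [prim]
  have ivl : ∀ {g : ℝ → ℝ}, Continuous g → ∀ a b, IntervalIntegrable g volume a b := fun h a b => h.intervalIntegrable a b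
  have cα := prim_cont α0 hα.i
  have cβ := prim_cont 0 hβ.i
  have cγ := prim_cont 0 hγ.i
  have cδ := prim_cont β0 hδ.i
  have cH := prim_cont 0 i3
  refine ⟨_, _, _, (r1.add r2).add r3, ?_, ?_⟩
  · intro x hx t ht ht0
    have e1 : (L - M) x + (cL - cM) = t := by simp; linarith
    simp only [e1, ht, hx, z0]
    constructor
    · have : prim 0 (prim 0 vH) t = - ∫ s in (0:ℝ)..t, prim 0 vβ s := by
        simp only [prim, zero_add]
        rw [← intervalIntegral.integral_neg]
        refine intervalIntegral.integral_congr fun s hs => ?_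
        rw [uIcc_of_le ht0] at hs
        have := (P s hs.1).1
        simpa [prim] using this
      rw [this]
      rw [show prim α0 (fun t => 1 * vα t + 1 * vβ t) = fun t => prim α0 vα t + prim 0 vβ t from funext P1]
      rw [show ∀ v, prim c0 v t = c0 + ∫ s in (0:ℝ)..t, v s from fun v => rfl,
        show ∀ v, prim c0 v t = c0 + ∫ s in (0:ℝ)..t, v s from fun v => rfl,
        intervalIntegral.integral_add (ivl cα _ _) (ivl cβ _ _)]
      ring
    · intro d
      rw [P1, (P t ht0).1, sh β0 vβ]
      simp; ring
  · intro x hx t ht ht0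
    have e1 : (L - M) x + (cL - cM) = -t := by simp; linarith
    simp only [e1, ht, hx, z0]
    constructor
    · have : prim 0 (prim 0 vH) (-t) = - ∫ s in (0:ℝ)..t, prim 0 vγ s := by
        have h1 := intervalIntegral.integral_comp_neg (a := 0) (b := t) (f := prim 0 vH)
        rw [neg_zero] at h1
        rw [show prim 0 (prim 0 vH) (-t) = 0 + ∫ s in (0:ℝ)..(-t), prim 0 vH s from rfl, zero_add,
          intervalIntegral.integral_symm, ← h1]
        congr 1
        refine intervalIntegral.integral_congr fun s hs => ?_
        rw [uIcc_of_le ht0] at hs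
        exact (P s hs.1).2
      rw [this]
      rw [show prim β0 (fun t => 1 * vδ t + 1 * vγ t) = fun t => prim β0 vδ t + prim 0 vγ t from funext P2]
      rw [show ∀ c v, prim c v t = c + ∫ s in (0:ℝ)..t, v s from fun c v => rfl,
        show ∀ v, prim c0 v t = c0 + ∫ s in (0:ℝ)..t, v s from fun v => rfl,
        intervalIntegral.integral_add (ivl cδ _ _) (ivl cγ _ _)]
      ring
    · intro d
      rw [P2, (P t ht0).2, sh α0 vγ]
      simp; ring

/-- edge data : every component of the gradient field is a primitive -/
lemma edge_data (p : Fin 3 → E2) {f g : Fin 3 → ℝ → ℝ} (hmem : MemBdryH2H1 f g) (j : Fin 3) (X : E2) :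
    ∃ v, Nice v ∧ ∀ t ∈ Icc (0:ℝ) 1, ⟪gfield p f g j t, X⟫ = prim ⟪gfield p f g j 0, X⟫ v t := by
  obtain ⟨h1, h2, h3, h4⟩ := hmem j
  obtain ⟨⟨wf, a1, a2, a3, a4, a5⟩, -⟩ := bdry_f h1 h2
  obtain ⟨wg, b1, b2, b3, b4, b5⟩ := bdry_g h3 h4
  have nf : Nice wf := ⟨a1, a2, a3, a4⟩
  have ng : Nice wg := ⟨b1, b2, b3, b4⟩
  have e : ∀ t, ⟪gfield p f g j t, X⟫ = ((elen p j)⁻¹ * ⟪tangv p j, X⟫) * derivWithin (f j) (Icc 0 1) t + ⟪norv p j, X⟫ * g j t := by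
    intro t
    simp only [gfield, inner_add_left, real_inner_smul_left]; ring
  refine ⟨_, nf.lin ng ((elen p j)⁻¹ * ⟪tangv p j, X⟫) ⟪norv p j, X⟫, fun t ht => ?_⟩
  rw [e t, e 0, prim_lin _ _ _ _ _ a2 b2, ← a5 t ht, ← b5 t ht]

lemma inner2 (x y : E2) : ⟪x, y⟫ = x 0 * y 0 + x 1 * y 1 := by
  simp [PiLp.inner_apply, Fin.sum_univ_two]; ring

def lamL (p : Fin 3 → E2) (i : Fin 3) : E2 →L[ℝ] ℝ :=
  (Dt p)⁻¹ • (evec p i 0 • (EuclideanSpace.proj 1 : E2 →L[ℝ] ℝ) - evec p i 1 • (EuclideanSpace.proj 0 : E2 →L[ℝ] ℝ))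

def lamc (p : Fin 3 → E2) (i : Fin 3) : ℝ := - lamL p i (p (i + 1))

def lam (p : Fin 3 → E2) (i : Fin 3) (x : E2) : ℝ := lamL p i x + lamc p i

lemma lamL_apply (p : Fin 3 → E2) (i : Fin 3) (x : E2) :
    lamL p i x = (evec p i 0 * x 1 - evec p i 1 * x 0) / Dt p := by
  simp [lamL]; ring

lemma lam_self (p : Fin 3 → E2) (i : Fin 3) (t : ℝ) : lam p i (epar p i t) = 0 := by
  simp only [lam, lamc, lamL_apply, epar]
  simp; ring

lemma lam_add1 {p : Fin 3 → E2} (hp : ccw p) (i : Fin 3) (t : ℝ) : lam p i (epar p (i + 1) t) = t := by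
  have hD : Dt p ≠ 0 := ne_of_gt hp
  simp only [lam, lamc, lamL_apply, epar]
  rw [← mul_right_inj' hD]
  rw [mul_add, mul_neg, mul_div_cancel₀ _ hD, mul_div_cancel₀ _ hD]
  fin_cases i <;> simp [evec, Dt] <;> ring

lemma lam_add2 {p : Fin 3 → E2} (hp : ccw p) (i : Fin 3) (t : ℝ) : lam p i (epar p (i + 2) t) = 1 - t := by
  have hD : Dt p ≠ 0 := ne_of_gt hp
  simp only [lam, lamc, lamL_apply, epar]
  rw [← mul_right_inj' hD]
  rw [mul_add, mul_neg, mul_div_cancel₀ _ hD, mul_div_cancel₀ _ hD]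
  fin_cases i <;> simp [evec, Dt] <;> ring

lemma lam_sum {p : Fin 3 → E2} (hp : ccw p) (x : E2) : lam p 0 x + lam p 1 x + lam p 2 x = 1 := by
  have hD : Dt p ≠ 0 := ne_of_gt hp
  simp only [lam, lamc, lamL_apply]
  rw [← mul_right_inj' hD]
  simp only [mul_add, mul_neg, mul_div_cancel₀ _ hD]
  simp [evec, Dt]; ring

lemma lam_dual {p : Fin 3 → E2} (hp : ccw p) (i : Fin 3) (x : E2) :
    x = lamL p (i + 1) x • evec p (i + 2) + lamL p (i + 2) x • (- evec p (i + 1)) := by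
  have hD : Dt p ≠ 0 := ne_of_gt hp
  have key : Dt p • x = (evec p (i+1) 0 * x 1 - evec p (i+1) 1 * x 0) • evec p (i + 2) +
      (evec p (i+2) 0 * x 1 - evec p (i+2) 1 * x 0) • (- evec p (i + 1)) := by
    ext k
    fin_cases i <;> fin_cases k <;> simp [evec, Dt] <;> ring
  rw [lamL_apply, lamL_apply, div_eq_inv_mul, div_eq_inv_mul, mul_smul, mul_smul, ← smul_add, ← key,
    smul_smul, inv_mul_cancel₀ hD, one_smul]

lemma evec_ne {p : Fin 3 → E2} (hp : ccw p) (j : Fin 3) : evec p j ≠ 0 := by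
  intro h
  have := lam_add1 hp (j + 2) 1
  have h2 := lam_add1 hp (j + 2) 0
  have e : j + 2 + 1 = j := by fin_cases j <;> rfl
  rw [e] at this h2
  simp [epar, h] at this h2
  linarith

lemma elen_ne {p : Fin 3 → E2} (hp : ccw p) (j : Fin 3) : elen p j ≠ 0 := norm_ne_zero_iff.2 (evec_ne hp j)

lemma tangv_sq {p : Fin 3 → E2} (hp : ccw p) (j : Fin 3) : tangv p j 0 ^ 2 + tangv p j 1 ^ 2 = 1 := by
  have h : elen p j ^ 2 = evec p j 0 ^ 2 + evec p j 1 ^ 2 := by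
    rw [elen, EuclideanSpace.norm_sq_eq]; simp [Fin.sum_univ_two]
  have h0 := elen_ne hp j
  simp only [tangv, PiLp.smul_apply, smul_eq_mul]
  field_simp
  linarith

lemma evec_tang {p : Fin 3 → E2} (hp : ccw p) (j : Fin 3) : evec p j = elen p j • tangv p j := by
  rw [tangv, smul_smul, mul_inv_cancel₀ (elen_ne hp j), one_smul]

lemma gfield_evec {p : Fin 3 → E2} (hp : ccw p) (f g : Fin 3 → ℝ → ℝ) (j : Fin 3) (t : ℝ) :
    ⟪gfield p f g j t, evec p j⟫ = derivWithin (f j) (Icc 0 1) t := by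
  have h0 := elen_ne hp j
  have h1 := tangv_sq hp j
  rw [evec_tang hp j, inner2]
  simp [gfield, norv]
  field_simp
  linear_combination (derivWithin (f j) (Icc 0 1) t) * h1

lemma gfield_vertex {p : Fin 3 → E2} (hp : ccw p) {f g : Fin 3 → ℝ → ℝ} {j : Fin 3} {t : ℝ} {w : E2}
    (h1 : derivWithin (f j) (Icc 0 1) t = elen p j * ⟪w, tangv p j⟫) (h2 : g j t = ⟪w, norv p j⟫) :
    gfield p f g j t = w := by
  have h0 := elen_ne hp j
  have h3 := tangv_sq hp j
  rw [gfield, h1, h2, inner2, inner2, ← mul_assoc, inv_mul_cancel₀ h0, one_mul]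
  ext k
  fin_cases k
  · simp [norv]; linear_combination (w 0) * h3
  · simp [norv]; linear_combination (w 1) * h3

lemma lamL_ne {p : Fin 3 → E2} (hp : ccw p) (i : Fin 3) : lamL p i ≠ 0 := by
  intro h
  have h1 := lam_add1 hp i 0
  have h2 := lam_add1 hp i 1
  simp [lam, h] at h1 h2
  linarith

lemma lamL_sub_ne {p : Fin 3 → E2} (hp : ccw p) (i : Fin 3) : lamL p (i + 1) - lamL p (i + 2) ≠ 0 := by
  intro h
  rw [sub_eq_zero] at h
  have h1 := lam_add1 hp (i + 1) 0
  have h2 := lam_add1 hp (i + 1) 1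
  have e : i + 1 + 1 = i + 2 := by fin_cases i <;> rfl
  have h3 := lam_self p (i + 2) 0
  have h4 := lam_self p (i + 2) 1
  rw [e] at h1 h2
  simp only [lam, h] at *
  linarith

lemma vertex_exists {p : Fin 3 → E2} (hp : ccw p) {f g : Fin 3 → ℝ → ℝ}
    (hmem : MemBdryH2H1 f g) (hcomp : Compat p f g) (i : Fin 3) :
    ∃ ζ G Hs, C1Lift p ζ G Hs ∧ ∀ j, j ≠ i → ∀ t ∈ Icc (0:ℝ) 1,
      ζ (epar p j t) = f j t ∧ ∀ d, G d (epar p j t) = gfield p f g j t d := by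
  obtain ⟨hc1, w, hw⟩ := hcomp
  have ne1 : i + 1 ≠ i := by fin_cases i <;> decide
  have ne2 : i + 2 ≠ i := by fin_cases i <;> decide
  have e11 : i + 1 + 1 = i + 2 := by fin_cases i <;> rfl
  have e22 : i + 2 + 2 = i + 1 := by fin_cases i <;> rfl
  have t1 : tau i (i + 1) = 1 := by fin_cases i <;> simp [tau]
  have t2 : tau i (i + 2) = 0 := by fin_cases i <;> simp [tau]
  have w1 : gfield p f g (i+1) 1 = w i := by
    have := hw i (i+1) ne1
    rw [t1] at this
    exact gfield_vertex hp this.1 this.2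
  have w2 : gfield p f g (i+2) 0 = w i := by
    have := hw i (i+2) ne2
    rw [t2] at this
    exact gfield_vertex hp this.1 this.2
  have hf0 : f (i+2) 0 = f (i+1) 1 := by
    have := hc1 i (i+2) (i+1) ne2 ne1
    rwa [t1, t2] at this
  set a := evec p (i+2) with ha
  set b := - evec p (i+1) with hb
  obtain ⟨vα, nα, pα⟩ := edge_data p hmem (i+2) a
  obtain ⟨vβ, nβ, pβ⟩ := edge_data p hmem (i+2) b
  obtain ⟨vγ, nγ, pγ⟩ := edge_data p hmem (i+1) a
  obtain ⟨vδ, nδ, pδ⟩ := edge_data p hmem (i+1) b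
  rw [w2] at pα pβ
  have one_mem : (1:ℝ) ∈ Icc (0:ℝ) 1 := by simp
  have pγ' : ∀ t ∈ Icc (0:ℝ) 1, ⟪gfield p f g (i+1) (1 - t), a⟫ = prim ⟪w i, a⟫ (fun t => - vγ (1 - t)) t := by
    intro t ht
    have h1 := pγ 1 one_mem
    rw [w1] at h1
    rw [pγ (1 - t) ⟨by linarith [ht.2], by linarith [ht.1]⟩, prim_refl _ _ nγ.i, ← h1]
  have pδ' : ∀ t ∈ Icc (0:ℝ) 1, ⟪gfield p f g (i+1) (1 - t), b⟫ = prim ⟪w i, b⟫ (fun t => - vδ (1 - t)) t := by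
    intro t ht
    have h1 := pδ 1 one_mem
    rw [w1] at h1
    rw [pδ (1 - t) ⟨by linarith [ht.2], by linarith [ht.1]⟩, prim_refl _ _ nδ.i, ← h1]
  obtain ⟨ζ, G, Hs, hC, hA, hB⟩ := vertex_lift hp (lamL_ne hp (i+1)) (lamL_ne hp (i+2)) (lamL_sub_ne hp i)
    (lamc p (i+1)) (lamc p (i+2)) (f (i+2) 0) ⟪w i, a⟫ ⟪w i, b⟫ nα nβ nγ.refl nδ.refl
  have comp : ∀ (X : E2) (d : Fin 2), ⟪X, a⟫ * lamL p (i+1) (stdb2 d) + ⟪X, b⟫ * lamL p (i+2) (stdb2 d) = X d := by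
    intro X d
    have h1 : ⟪X, stdb2 d⟫ = X d := by rw [inner2]; fin_cases d <;> simp [stdb2]
    rw [← h1]
    conv_rhs => rw [lam_dual hp i (stdb2 d)]
    rw [inner_add_right, real_inner_smul_right, real_inner_smul_right]; ring
  refine ⟨ζ, G, Hs, hC, ?_⟩
  intro j hj t ht
  have hj' : j = i + 2 ∨ j = i + 1 := by revert hj; fin_cases i <;> fin_cases j <;> simp
  rcases hj' with rfl | rfl
  · obtain ⟨k1, k2⟩ := hA (epar p (i+2) t) (lam_self p (i+2) t) t
      (by have := lam_add1 hp (i+1) t; rwa [e11] at this) ht.1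
    constructor
    · rw [k1]
      obtain ⟨m1, m2, -, -⟩ := hmem (i+2)
      rw [(bdry_f m1 m2).2 t ht]
      simp only [prim]
      congr 1
      refine intervalIntegral.integral_congr fun s hs => ?_
      rw [uIcc_of_le ht.1] at hs
      have := pα s ⟨hs.1, hs.2.trans ht.2⟩
      rw [gfield_evec hp] at this
      simp only [prim] at this
      rw [this]
    · intro d
      rw [k2 d, ← pα t ht, ← pβ t ht, comp]
  · have ht' : 1 - t ∈ Icc (0:ℝ) 1 := ⟨by linarith [ht.2], by linarith [ht.1]⟩
    obtain ⟨k1, k2⟩ := hB (epar p (i+1) t) (lam_self p (i+1) t) (1 - t)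
      (by have := lam_add2 hp (i+2) t; rwa [e22] at this) ht'.1
    constructor
    · rw [k1]
      obtain ⟨m1, m2, -, -⟩ := hmem (i+1)
      have hdc : ContinuousOn (derivWithin (f (i+1)) (Icc 0 1)) (Icc 0 1) :=
        m2.continuousOn_derivWithin (uniqueDiffOn_Icc zero_lt_one) le_rfl
      have q1 := (bdry_f m1 m2).2 t ht
      have q2 := (bdry_f m1 m2).2 1 one_mem
      have i1 : IntervalIntegrable (derivWithin (f (i+1)) (Icc 0 1)) volume 0 t := by
        apply ContinuousOn.intervalIntegrable
        rw [uIcc_of_le ht.1]; exact hdc.mono (Icc_subset_Icc_right ht.2)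
      have i2 : IntervalIntegrable (derivWithin (f (i+1)) (Icc 0 1)) volume t 1 := by
        apply ContinuousOn.intervalIntegrable
        rw [uIcc_of_le ht.2]; exact hdc.mono (Icc_subset_Icc_left ht.1)
      have q3 := intervalIntegral.integral_add_adjacent_intervals i1 i2
      have q4 : ∫ s in (0:ℝ)..(1 - t), prim ⟪w i, b⟫ (fun t => - vδ (1 - t)) s = ∫ s in (0:ℝ)..(1 - t), - derivWithin (f (i+1)) (Icc 0 1) (1 - s) := by
        refine intervalIntegral.integral_congr fun s hs => ?_
        rw [uIcc_of_le ht'.1] at hs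
        have := pδ' s ⟨hs.1, hs.2.trans ht'.2⟩
        rw [hb, inner_neg_right, gfield_evec hp] at this
        exact this.symm
      rw [show ∀ c v, prim c v (1 - t) = c + ∫ s in (0:ℝ)..(1 - t), v s from fun c v => rfl, q4,
        intervalIntegral.integral_neg, intervalIntegral.integral_comp_sub_left (fun s => derivWithin (f (i+1)) (Icc 0 1) s) 1]
      simp only [sub_sub_cancel, sub_zero]
      rw [hf0]
      linarith
    · intro d
      have g1 := pγ' (1 - t) ht'
      have g2 := pδ' (1 - t) ht'
      rw [sub_sub_cancel] at g1 g2
      rw [k2 d, ← g1, ← g2, comp]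

def thq (p : Fin 3 → E2) (i : Fin 3) (x : E2) : ℝ :=
  lam p i x ^ 2 + 4 * lam p i x * (lam p (i+1) x + lam p (i+2) x) + 3 * (lam p (i+1) x ^ 2 + lam p (i+2) x ^ 2)
    + 12 * lam p (i+1) x * lam p (i+2) x

def theta (p : Fin 3 → E2) (i : Fin 3) (x : E2) : ℝ := lam p i x ^ 2 * thq p i x

lemma lam_smooth (p : Fin 3 → E2) (i : Fin 3) : ContDiff ℝ (⊤ : ℕ∞) (lam p i) :=
  (lamL p i).contDiff.add contDiff_const

lemma thq_smooth (p : Fin 3 → E2) (i : Fin 3) : ContDiff ℝ (⊤ : ℕ∞) (thq p i) := by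
  have := lam_smooth p
  have h0 := this i
  have h1 := this (i+1)
  have h2 := this (i+2)
  unfold thq
  fun_prop

lemma theta_smooth (p : Fin 3 → E2) (i : Fin 3) : ContDiff ℝ (⊤ : ℕ∞) (theta p i) :=
  ((lam_smooth p i).pow 2).mul (thq_smooth p i)

lemma theta_edge (p : Fin 3 → E2) (i : Fin 3) (t : ℝ) :
    theta p i (epar p i t) = 0 ∧ fderiv ℝ (theta p i) (epar p i t) = 0 := by
  have h := lam_self p i t
  refine ⟨by simp [theta, h], ?_⟩
  have d1 := (lam_smooth p i).differentiable (by simp) (epar p i t)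
  have d2 := (thq_smooth p i).differentiable (by simp) (epar p i t)
  have e : theta p i = fun x => lam p i x ^ 2 * thq p i x := rfl
  have d1' : DifferentiableAt ℝ (fun x => lam p i x ^ 2) (epar p i t) := d1.pow 2
  rw [e, fderiv_fun_mul d1' d2, fderiv_fun_pow 2 d1, h]
  simp

lemma theta_sum {p : Fin 3 → E2} (hp : ccw p) (x : E2) :
    theta p 0 x + theta p 1 x + theta p 2 x = 1 ∧
    ∀ v, fderiv ℝ (theta p 0) x v + fderiv ℝ (theta p 1) x v + fderiv ℝ (theta p 2) x v = 0 := by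
  have h1 : ∀ x, theta p 0 x + theta p 1 x + theta p 2 x = 1 := by
    intro x
    have := lam_sum hp x
    have h4 : (lam p 0 x + lam p 1 x + lam p 2 x) ^ 4 = 1 := by rw [this]; norm_num
    rw [← h4]
    simp only [theta, thq]
    simp; ring
  refine ⟨h1 x, fun v => ?_⟩
  have d := fun i => (theta_smooth p i).differentiable (by simp) x
  have h2 : fderiv ℝ (fun x => theta p 0 x + theta p 1 x + theta p 2 x) x = 0 := by
    rw [funext h1]; simp
  have d01 : DifferentiableAt ℝ (fun x => theta p 0 x + theta p 1 x) x := (d 0).add (d 1)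
  rw [fderiv_fun_add d01 (d 2), fderiv_fun_add (d 0) (d 1)] at h2
  simpa using congrArg (fun T => T v) h2

lemma lift_exists {p : Fin 3 → E2} (hp : ccw p) {f g : Fin 3 → ℝ → ℝ}
    (hmem : MemBdryH2H1 f g) (hcomp : Compat p f g) :
    ∃ ζ G Hs, C1Lift p ζ G Hs ∧ ∀ j, ∀ t ∈ Icc (0:ℝ) 1,
      ζ (epar p j t) = f j t ∧ ∀ d, G d (epar p j t) = gfield p f g j t d := by
  choose ζ G Hs hC hv using vertex_exists hp hmem hcomp
  refine ⟨_, _, _, (((hC 0).smul (theta_smooth p 0)).add ((hC 1).smul (theta_smooth p 1))).add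
    ((hC 2).smul (theta_smooth p 2)), ?_⟩
  intro j t ht
  obtain ⟨s1, s2⟩ := theta_sum hp (epar p j t)
  obtain ⟨e1, e2⟩ := theta_edge p j t
  have val : ∀ i, j ≠ i → ζ i (epar p j t) = f j t := fun i hi => (hv i j hi t ht).1
  have valG : ∀ i, j ≠ i → ∀ d, G i d (epar p j t) = gfield p f g j t d := fun i hi => (hv i j hi t ht).2
  constructor
  · have : ∀ i, theta p i (epar p j t) * ζ i (epar p j t) = theta p i (epar p j t) * f j t := by
      intro i
      by_cases hi : j = i
      · subst hi; rw [e1]; simp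
      · rw [val i hi]
    simp only [this]
    linear_combination (f j t) * s1
  · intro d
    have : ∀ i, theta p i (epar p j t) * G i d (epar p j t) + fderiv ℝ (theta p i) (epar p j t) (stdb2 d) * ζ i (epar p j t)
        = theta p i (epar p j t) * gfield p f g j t d + fderiv ℝ (theta p i) (epar p j t) (stdb2 d) * f j t := by
      intro i
      by_cases hi : j = i
      · subst hi; rw [e1, e2]; simp
      · rw [val i hi, valG i hi d]
    simp only [this]
    linear_combination (gfield p f g j t d) * s1 + (f j t) * s2 (stdb2 d)

/-- smooth compactly supported functions on the plane -/
structure Tst (φ : E2 → ℝ) : Prop where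
  sm : ContDiff ℝ (⊤ : ℕ∞) φ
  cs : HasCompactSupport φ

def pd (i : Fin 2) (φ : E2 → ℝ) : E2 → ℝ := fun x => fderiv ℝ φ x (stdb2 i)

lemma pd_sm {φ : E2 → ℝ} (h : ContDiff ℝ (⊤ : ℕ∞) φ) (i : Fin 2) : ContDiff ℝ (⊤ : ℕ∞) (pd i φ) :=
  (h.fderiv_right (m := (⊤ : ℕ∞)) (by simp)).clm_apply contDiff_const

lemma pd_supp (φ : E2 → ℝ) (i : Fin 2) : tsupport (pd i φ) ⊆ tsupport φ :=
  tsupport_fderiv_apply_subset ℝ (stdb2 i)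

lemma Tst.pd {φ : E2 → ℝ} (h : Tst φ) (i : Fin 2) : Tst (pd i φ) :=
  ⟨pd_sm h.sm i, h.cs.fderiv_apply ℝ (stdb2 i)⟩

lemma pd_comm {φ : E2 → ℝ} (h : ContDiff ℝ (⊤ : ℕ∞) φ) (i j : Fin 2) : pd i (pd j φ) = pd j (pd i φ) := by
  funext x
  have hd : DifferentiableAt ℝ (fderiv ℝ φ) x :=
    ((h.fderiv_right (m := (⊤ : ℕ∞)) (by simp)).differentiable (by simp)) x
  have e : ∀ a b : Fin 2, pd a (pd b φ) x = fderiv ℝ (fderiv ℝ φ) x (stdb2 a) (stdb2 b) := by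
    intro a b
    unfold pd
    rw [fderiv_clm_apply hd (by fun_prop)]
    simp
  rw [e, e]
  have hs : IsSymmSndFDerivAt ℝ φ x := h.contDiffAt.isSymmSndFDerivAt (by simp only [minSmoothness_of_isRCLikeNormedField]; exact WithTop.coe_le_coe.2 le_top)
  exact hs.eq _ _

lemma lap_eq (φ : E2 → ℝ) : lap φ = fun x => pd 0 (pd 0 φ) x + pd 1 (pd 1 φ) x := by
  funext x; simp only [lap, Fin.sum_univ_two]; rfl

lemma Tst.add {φ ψ : E2 → ℝ} (h : Tst φ) (h' : Tst ψ) : Tst (fun x => φ x + ψ x) :=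
  ⟨h.sm.add h'.sm, h.cs.add h'.cs⟩
lemma Tst.sub {φ ψ : E2 → ℝ} (h : Tst φ) (h' : Tst ψ) : Tst (fun x => φ x - ψ x) :=
  ⟨h.sm.sub h'.sm, by
    have e : (fun x => φ x - ψ x) = φ + -ψ := by funext x; simp [sub_eq_add_neg]
    rw [e]; exact h.cs.add h'.cs.neg⟩
lemma Tst.cmul {φ : E2 → ℝ} (h : Tst φ) (c : ℝ) : Tst (fun x => c * φ x) :=
  ⟨contDiff_const.mul h.sm, h.cs.mul_left⟩
lemma Tst.smul {φ ψ : E2 → ℝ} (h : Tst φ) (h' : ContDiff ℝ (⊤ : ℕ∞) ψ) : Tst (fun x => ψ x * φ x) :=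
  ⟨h'.mul h.sm, h.cs.mul_left⟩
lemma Tst.lap {φ : E2 → ℝ} (h : Tst φ) : Tst (lap φ) := by
  rw [lap_eq]; exact ((h.pd 0).pd 0).add ((h.pd 1).pd 1)
lemma Tst.cont {φ : E2 → ℝ} (h : Tst φ) : Continuous φ := h.sm.continuous
lemma Tst.int {φ : E2 → ℝ} (h : Tst φ) : Integrable φ := h.cont.integrable_of_hasCompactSupport h.cs
lemma Tst.diff {φ : E2 → ℝ} (h : Tst φ) : Differentiable ℝ φ := h.sm.differentiable (by simp)

lemma ibp {φ ψ : E2 → ℝ} (h : Tst φ) (h' : ContDiff ℝ (⊤ : ℕ∞) ψ) (i : Fin 2) :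
    ∫ x, ψ x * pd i φ x = - ∫ x, pd i ψ x * φ x := by
  exact integral_mul_fderiv_eq_neg_fderiv_mul_of_integrable (h.smul (pd_sm h' i)).int
    ((h.pd i).smul h').int (h.smul h').int (fun x _ => h'.differentiable (by simp) x) (fun x _ => h.diff x)

lemma energy {φ : E2 → ℝ} (h : Tst φ) (i j : Fin 2) :
    ∫ x, pd i (pd j φ) x ^ 2 = ∫ x, pd i (pd i φ) x * pd j (pd j φ) x := by
  have e1 : ∫ x, pd i (pd j φ) x ^ 2 = - ∫ x, pd i (pd i (pd j φ)) x * pd j φ x := by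
    rw [← ibp (h.pd j) (((h.pd j).pd i).sm) i]
    simp only [sq]
  have e2 := ibp (h.pd j) ((h.pd i).pd i).sm j
  rw [e1, e2]
  have : pd i (pd i (pd j φ)) = pd j (pd i (pd i φ)) := by
    rw [pd_comm h.sm i j, pd_comm (h.pd i).sm i j]
  rw [this]

lemma energy_lap {φ : E2 → ℝ} (h : Tst φ) (i j : Fin 2) :
    ∫ x, pd i (pd j φ) x ^ 2 ≤ ∫ x, lap φ x ^ 2 := by
  have T : ∀ i j, Integrable (fun x => pd i (pd j φ) x ^ 2) := fun i j => by
    simpa only [sq] using (((h.pd j).pd i).smul ((h.pd j).pd i).sm).int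
  have Tx : Integrable (fun x => pd 0 (pd 0 φ) x * pd 1 (pd 1 φ) x) :=
    (((h.pd 1).pd 1).smul ((h.pd 0).pd 0).sm).int
  have T2 : Integrable (fun x => pd 0 (pd 0 φ) x ^ 2 + pd 1 (pd 1 φ) x ^ 2) := (T 0 0).add (T 1 1)
  have e : ∫ x, lap φ x ^ 2 = (∫ x, pd 0 (pd 0 φ) x ^ 2) + (∫ x, pd 1 (pd 1 φ) x ^ 2)
      + 2 * ∫ x, pd 0 (pd 1 φ) x ^ 2 := by
    rw [energy h 0 1, ← integral_const_mul, ← integral_add (T 0 0) (T 1 1), ← integral_add T2 (Tx.const_mul 2)]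
    congr 1; funext x; rw [lap_eq]; ring
  have n : ∀ i j, 0 ≤ ∫ x, pd i (pd j φ) x ^ 2 := fun i j => integral_nonneg fun x => sq_nonneg _
  have c := pd_comm h.sm 1 0
  have n1 := n 0 0
  have n2 := n 1 1
  have n3 := n 0 1
  rw [e]
  fin_cases i <;> fin_cases j <;> simp only [Fin.zero_eta, Fin.mk_one]
  · linarith
  · linarith
  · rw [c]; linarith
  · linarith

lemma poincare {φ : E2 → ℝ} (h : Tst φ) {R : ℝ} (hR : ∀ x, φ x ≠ 0 → ‖x‖ ≤ R) (d : Fin 2) :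
    ∫ x, φ x ^ 2 ≤ 4 * R ^ 2 * ∫ x, pd d φ x ^ 2 := by
  have hc : ContDiff ℝ (⊤ : ℕ∞) (fun x : E2 => x d) := (EuclideanSpace.proj (𝕜 := ℝ) d).contDiff
  have T1 : Integrable (fun x => φ x ^ 2) := by simpa only [sq] using (h.smul h.sm).int
  have T2 : Integrable (fun x => pd d φ x ^ 2) := by simpa only [sq] using ((h.pd d).smul (h.pd d).sm).int
  have T3 : Integrable (fun x : E2 => x d * φ x * pd d φ x) := ((h.pd d).smul (hc.mul h.sm)).int
  have e := ibp h (hc.mul h.sm) d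
  have e2 : ∀ x : E2, pd d (fun y : E2 => y d * φ y) x = φ x + x d * pd d φ x := by
    intro x
    unfold pd
    have hx : DifferentiableAt ℝ (fun x : E2 => x d) x := (EuclideanSpace.proj (𝕜 := ℝ) d).differentiableAt
    rw [fderiv_fun_mul hx h.diff.differentiableAt]
    have : fderiv ℝ (fun x : E2 => x d) x = EuclideanSpace.proj (𝕜 := ℝ) d :=
      (EuclideanSpace.proj (𝕜 := ℝ) d).fderiv
    rw [this]
    simp [stdb2]; ring
  simp only [e2] at e
  have z : ∫ x : E2, (φ x ^ 2 + 2 * (x d * φ x * pd d φ x)) = 0 := by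
    rw [integral_add T1 (T3.const_mul 2), integral_const_mul]
    have : ∫ x : E2, (φ x + x d * pd d φ x) * φ x = (∫ x, φ x ^ 2) + ∫ x : E2, x d * φ x * pd d φ x := by
      rw [← integral_add T1 T3]; congr 1; funext x; ring
    rw [this] at e
    linarith
  have key : ∫ x, (φ x ^ 2 / 2 - 2 * R ^ 2 * pd d φ x ^ 2) ≤ ∫ x : E2, (φ x ^ 2 + 2 * (x d * φ x * pd d φ x)) := by
    refine integral_mono ((T1.div_const 2).sub (T2.const_mul _)) (T1.add (T3.const_mul 2)) fun x => ?_
    by_cases hx : φ x = 0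
    · simp [hx]; positivity
    · have h1 := hR x hx
      have h2 : |x d| ≤ ‖x‖ := by simpa using EuclideanSpace.norm_eq x ▸ (PiLp.norm_apply_le x d)
      have h3 : x d ^ 2 ≤ R ^ 2 := sq_le_sq' (by linarith [neg_abs_le (x d)]) (by linarith [le_abs_self (x d)])
      have := mul_le_mul_of_nonneg_right h3 (sq_nonneg (pd d φ x))
      show φ x ^ 2 / 2 - 2 * R ^ 2 * pd d φ x ^ 2 ≤ φ x ^ 2 + 2 * (x d * φ x * pd d φ x)
      nlinarith [sq_nonneg (φ x + 2 * (x d * pd d φ x))]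
  rw [z, integral_sub (T1.div_const 2) (T2.const_mul _), integral_const_mul, integral_div] at key
  linarith

lemma pd_zero_of {φ : E2 → ℝ} {R : ℝ} (hR : tsupport φ ⊆ Metric.closedBall 0 R) {x : E2}
    (h : φ x ≠ 0) : ‖x‖ ≤ R := by
  simpa using hR (subset_tsupport φ h)

lemma pd_bound {φ : E2 → ℝ} (h : Tst φ) {R : ℝ} (hR : tsupport φ ⊆ Metric.closedBall 0 R) (i : Fin 2) :
    ∫ x, pd i φ x ^ 2 ≤ 4 * R ^ 2 * ∫ x, lap φ x ^ 2 :=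
  (poincare (h.pd i) (fun _ hx => pd_zero_of ((pd_supp φ i).trans hR) hx) i).trans
    (mul_le_mul_of_nonneg_left (energy_lap h i i) (by positivity))

lemma phi_bound {φ : E2 → ℝ} (h : Tst φ) {R : ℝ} (hR : tsupport φ ⊆ Metric.closedBall 0 R) :
    ∫ x, φ x ^ 2 ≤ 4 * R ^ 2 * (4 * R ^ 2 * ∫ x, lap φ x ^ 2) :=
  (poincare h (fun _ hx => pd_zero_of hR hx) 0).trans
    (mul_le_mul_of_nonneg_left (pd_bound h hR 0) (by positivity))

/-- Lax-Milgram type lemma -/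
lemma hilbert_solve {V H : Type*} [AddCommGroup V] [Module ℝ V] [NormedAddCommGroup H]
    [InnerProductSpace ℝ H] [CompleteSpace H] (A : V →ₗ[ℝ] H) (l : V →ₗ[ℝ] ℝ) (C : ℝ)
    (hC : ∀ v, |l v| ≤ C * ‖A v‖) :
    ∃ k ∈ (LinearMap.range A).topologicalClosure, ∀ v, ⟪k, A v⟫ = l v := by
  have hinv : ∀ v w, A v = A w → l v = l w := by
    intro v w h
    have := hC (v - w)
    rw [map_sub, map_sub, h] at this
    simp at this
    linarith
  choose s hs using fun y : LinearMap.range A => y.2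
  have hls : ∀ v, l (s ⟨A v, v, rfl⟩) = l v := fun v => hinv _ _ (hs _)
  let l' : LinearMap.range A →ₗ[ℝ] ℝ :=
    { toFun := fun y => l (s y)
      map_add' := fun y z => by
        rw [← map_add]; apply hinv; rw [map_add, hs, hs, hs]; rfl
      map_smul' := fun c y => by
        rw [RingHom.id_apply, ← map_smul]; apply hinv; rw [map_smul, hs, hs]; rfl }
  let L : StrongDual ℝ (LinearMap.range A) := l'.mkContinuous C (fun y => by
    have := hC (s y)
    rw [hs] at this
    exact this)
  obtain ⟨L', hL', -⟩ := exists_extension_norm_eq (LinearMap.range A) L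
  let k0 := (InnerProductSpace.toDual ℝ H).symm L'
  have hk0 : ∀ v, ⟪k0, A v⟫ = l v := by
    intro v
    rw [InnerProductSpace.toDual_symm_apply]
    exact (hL' ⟨A v, v, rfl⟩).trans (hls v)
  have : CompleteSpace (LinearMap.range A).topologicalClosure :=
    (Submodule.isClosed_topologicalClosure _).completeSpace_coe
  refine ⟨(LinearMap.range A).topologicalClosure.starProjection k0, Submodule.starProjection_apply_mem _ _, fun v => ?_⟩
  rw [← hk0 v]
  have hm : A v ∈ (LinearMap.range A).topologicalClosure := Submodule.le_topologicalClosure _ ⟨v, rfl⟩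
  rw [Submodule.inner_starProjection_left_eq_right, Submodule.starProjection_eq_self_iff.2 hm]

lemma bdd_limit {V H : Type*} [AddCommGroup V] [Module ℝ V] [NormedAddCommGroup H]
    [InnerProductSpace ℝ H] [CompleteSpace H] (A B : V →ₗ[ℝ] H) (C : ℝ)
    (hC : ∀ v, ‖B v‖ ≤ C * ‖A v‖) (φ : ℕ → V) (k : H)
    (hk : Filter.Tendsto (fun n => A (φ n)) Filter.atTop (nhds k)) :
    ∃ b, Filter.Tendsto (fun n => B (φ n)) Filter.atTop (nhds b) := by
  apply cauchySeq_tendsto_of_complete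
  have h := hk.cauchySeq
  have hC' : ∀ v, ‖B v‖ ≤ (|C| + 1) * ‖A v‖ := fun v => (hC v).trans
    (mul_le_mul_of_nonneg_right ((le_abs_self C).trans (by linarith)) (norm_nonneg _))
  rw [Metric.cauchySeq_iff] at h ⊢
  intro ε hε
  have hp : 0 < |C| + 1 := by positivity
  obtain ⟨N, hN⟩ := h (ε / (|C| + 1)) (by positivity)
  refine ⟨N, fun m hm n hn => ?_⟩
  have := hN m hm n hn
  rw [dist_eq_norm, ← map_sub] at this ⊢
  refine (hC' _).trans_lt ?_
  rw [lt_div_iff₀ hp] at this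
  linarith

abbrev LTr (p : Fin 3 → E2) := Lp ℝ 2 ((volume : Measure E2).restrict (tri p))

lemma inner_cl {p : Fin 3 → E2} (U : LTr p) {F : E2 → ℝ} (hF : L2on (tri p) F) :
    ⟪U, hF.toLp F⟫ = ∫ x in tri p, U x * F x := by
  rw [L2.inner_def]
  apply integral_congr_ae
  filter_upwards [hF.coeFn_toLp] with x hx
  rw [hx]; simp [mul_comm]

lemma inner_cl2 {p : Fin 3 → E2} {U F : E2 → ℝ} (hU : L2on (tri p) U) (hF : L2on (tri p) F) :
    ⟪(hU.toLp U : LTr p), hF.toLp F⟫ = ∫ x in tri p, U x * F x := by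
  rw [inner_cl]
  apply integral_congr_ae
  filter_upwards [hU.coeFn_toLp] with x hx
  rw [hx]

lemma norm_cl {p : Fin 3 → E2} {F : E2 → ℝ} (hF : L2on (tri p) F) (hs : tsupport F ⊆ tri p) :
    ‖(hF.toLp F : LTr p)‖ ^ 2 = ∫ x, F x ^ 2 := by
  rw [← real_inner_self_eq_norm_sq, inner_cl2, setIntegral_eq_integral_of_forall_compl_eq_zero]
  · simp only [sq]
  · intro x hx
    rw [image_eq_zero_of_notMem_tsupport (fun h => hx (hs h)), mul_zero]

def TD (p : Fin 3 → E2) : Submodule ℝ (E2 → ℝ) where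
  carrier := {φ | Tst φ ∧ tsupport φ ⊆ tri p}
  add_mem' := fun {a b} ha hb => ⟨ha.1.add hb.1, (tsupport_add a b).trans (union_subset ha.2 hb.2)⟩
  zero_mem' := ⟨⟨contDiff_const, HasCompactSupport.zero⟩, by simp [tsupport]⟩
  smul_mem' := fun c φ h => ⟨h.1.cmul c, (tsupport_smul_subset_right (fun _ => c) φ).trans h.2⟩

lemma toT_add {p : Fin 3 → E2} {F G K : E2 → ℝ} (hF : L2on (tri p) F) (hG : L2on (tri p) G)
    (hK : L2on (tri p) K) (e : K = F + G) :
    (hK.toLp K : LTr p) = hF.toLp F + hG.toLp G := by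
  subst e; exact MemLp.toLp_add hF hG

lemma toT_smul {p : Fin 3 → E2} {F K : E2 → ℝ} (c : ℝ) (hF : L2on (tri p) F)
    (hK : L2on (tri p) K) (e : K = c • F) :
    (hK.toLp K : LTr p) = c • hF.toLp F := by
  subst e; exact MemLp.toLp_const_smul c hF

def mkT (p : Fin 3 → E2) (F : TD p → E2 → ℝ) (hc : ∀ v, Continuous (F v))
    (ha : ∀ v w, F (v + w) = F v + F w) (hs : ∀ (c : ℝ) v, F (c • v) = c • F v) : TD p →ₗ[ℝ] LTr p where
  toFun v := (l2T p (hc v)).toLp (F v)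
  map_add' v w :=
    toT_add (l2T p (hc v)) (l2T p (hc w)) (l2T p (hc (v + w))) (ha v w)
  map_smul' c v :=
    toT_smul c (l2T p (hc v)) (l2T p (hc (c • v))) (hs c v)

lemma pd_add {φ ψ : E2 → ℝ} (h : Tst φ) (h' : Tst ψ) (i : Fin 2) : pd i (φ + ψ) = pd i φ + pd i ψ := by
  funext x
  simp only [pd, Pi.add_apply]
  rw [fderiv_add (h.diff x) (h'.diff x)]; rfl

lemma pd_csmul {φ : E2 → ℝ} (h : Tst φ) (c : ℝ) (i : Fin 2) : pd i (c • φ) = c • pd i φ := by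
  funext x
  simp only [pd, Pi.smul_apply]
  rw [fderiv_const_smul (h.diff x)]; rfl

def opZ (p : Fin 3 → E2) : TD p →ₗ[ℝ] LTr p :=
  mkT p (fun v => v.1) (fun v => v.2.1.cont) (fun _ _ => rfl) (fun _ _ => rfl)
def opP (p : Fin 3 → E2) (i : Fin 2) : TD p →ₗ[ℝ] LTr p :=
  mkT p (fun v => pd i v.1) (fun v => (v.2.1.pd i).cont) (fun v w => pd_add v.2.1 w.2.1 i)
    (fun c v => pd_csmul v.2.1 c i)
def opQ (p : Fin 3 → E2) (i j : Fin 2) : TD p →ₗ[ℝ] LTr p :=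
  mkT p (fun v => pd j (pd i v.1)) (fun v => ((v.2.1.pd i).pd j).cont)
    (fun v w => by
      rw [← pd_add (v.2.1.pd i) (w.2.1.pd i), ← pd_add v.2.1 w.2.1]; rfl)
    (fun c v => by
      rw [← pd_csmul (v.2.1.pd i), ← pd_csmul v.2.1]; rfl)
def opA (p : Fin 3 → E2) : TD p →ₗ[ℝ] LTr p := opQ p 0 0 + opQ p 1 1

lemma opA_eq (p : Fin 3 → E2) (v : TD p) : opA p v = (l2T p v.2.1.lap.cont).toLp (lap v.1) := by
  have h0 := l2T p ((v.2.1.pd 0).pd 0).cont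
  have h1 := l2T p ((v.2.1.pd 1).pd 1).cont
  exact ((MemLp.toLp_congr (l2T p v.2.1.lap.cont) (MemLp.add h0 h1) (by rw [lap_eq]; rfl)).trans
    (MemLp.toLp_add h0 h1)).symm

lemma lap_supp (φ : E2 → ℝ) : tsupport (lap φ) ⊆ tsupport φ := by
  rw [lap_eq]
  exact (tsupport_add _ _).trans (union_subset ((pd_supp _ _).trans (pd_supp _ _)) ((pd_supp _ _).trans (pd_supp _ _)))

lemma op_bounds (p : Fin 3 → E2) : ∃ C : ℝ, 0 ≤ C ∧ ∀ v : TD p, ‖opZ p v‖ ≤ C * ‖opA p v‖ ∧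
    (∀ i, ‖opP p i v‖ ≤ C * ‖opA p v‖) ∧ ∀ i j, ‖opQ p i j v‖ ≤ C * ‖opA p v‖ := by
  obtain ⟨R, hR⟩ := (hull_compact p).isBounded.subset_closedBall 0
  refine ⟨1 + 4 * R ^ 2, by positivity, fun v => ?_⟩
  have hs := v.2.2
  have hR' : tsupport v.1 ⊆ Metric.closedBall 0 R := hs.trans ((tri_sub p).trans hR)
  have nA : ‖opA p v‖ ^ 2 = ∫ x, lap v.1 x ^ 2 := by
    rw [opA_eq]; exact norm_cl _ ((lap_supp _).trans hs)
  have nZ : ‖opZ p v‖ ^ 2 = ∫ x, v.1 x ^ 2 := norm_cl (l2T p v.2.1.cont) hs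
  have nP : ∀ i, ‖opP p i v‖ ^ 2 = ∫ x, pd i v.1 x ^ 2 := fun i =>
    norm_cl (l2T p (v.2.1.pd i).cont) ((pd_supp _ _).trans hs)
  have nQ : ∀ i j, ‖opQ p i j v‖ ^ 2 = ∫ x, pd j (pd i v.1) x ^ 2 := fun i j =>
    norm_cl (l2T p ((v.2.1.pd i).pd j).cont) ((pd_supp _ _).trans ((pd_supp _ _).trans hs))
  have a0 : 0 ≤ ‖opA p v‖ ^ 2 := by positivity
  have hz := phi_bound v.2.1 hR'
  have hP := fun i => pd_bound v.2.1 hR' i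
  have hQ := fun i j => energy_lap v.2.1 i j
  rw [← nA] at hz
  simp only [← nA] at hP hQ
  have r0 : 0 ≤ R ^ 2 := by positivity
  refine ⟨?_, fun i => ?_, fun i j => ?_⟩ <;> refine le_of_sq_le_sq ?_ (by positivity)
  · rw [nZ, mul_pow]; nlinarith [mul_nonneg r0 a0]
  · rw [nP, mul_pow]; nlinarith [hP i, mul_nonneg r0 a0, mul_nonneg (mul_nonneg r0 r0) a0]
  · rw [nQ, mul_pow]; nlinarith [hQ j i, mul_nonneg r0 a0, mul_nonneg (mul_nonneg r0 r0) a0]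

lemma ibp_tri {p : Fin 3 → E2} (v : TD p) {ψ : E2 → ℝ} (h' : ContDiff ℝ (⊤ : ℕ∞) ψ) (i : Fin 2) :
    (∫ x in tri p, v.1 x * pd i ψ x) + ∫ x in tri p, pd i v.1 x * ψ x = 0 := by
  have hs := v.2.2
  rw [setIntegral_eq_integral_of_forall_compl_eq_zero, setIntegral_eq_integral_of_forall_compl_eq_zero]
  · have := ibp v.2.1 h' i
    simp only [mul_comm (ψ _), mul_comm (pd i ψ _)] at this
    rw [this]; ring
  · intro x hx
    rw [image_eq_zero_of_notMem_tsupport (fun h => hx (hs (pd_supp _ i h))), zero_mul]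
  · intro x hx
    rw [image_eq_zero_of_notMem_tsupport (fun h => hx (hs h)), zero_mul]

def pdT {p : Fin 3 → E2} (v : TD p) (i : Fin 2) : TD p := ⟨pd i v.1, v.2.1.pd i, (pd_supp _ _).trans v.2.2⟩

/-- limits of test functions have vanishing face traces -/
lemma hft_limit {p : Fin 3 → E2} (φ : ℕ → TD p) (U : LTr p) (D : Fin 2 → LTr p)
    (hU : Filter.Tendsto (fun n => opZ p (φ n)) Filter.atTop (nhds U))
    (hD : ∀ d, Filter.Tendsto (fun n => opP p d (φ n)) Filter.atTop (nhds (D d))) :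
    HasFaceTrace p U (fun d => D d) (fun _ _ => 0) := by
  rw [hft_iff]
  intro ψ h1 h2 d
  have hψ : Tst ψ := ⟨h1, h2⟩
  have l1 := l2T p (hψ.pd d).cont
  have l2 := l2T p hψ.cont
  simp only [zero_mul, integral_zero, mul_zero, Finset.sum_const_zero]
  have e : ∫ x in tri p, (U x * fderiv ℝ ψ x (stdb2 d) + D d x * ψ x) =
      (∫ x in tri p, U x * pd d ψ x) + ∫ x in tri p, D d x * ψ x :=
    integral_add (l2mul (Lp.memLp U) (hψ.pd d).cont) (l2mul (Lp.memLp (D d)) hψ.cont)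
  rw [e, ← inner_cl U l1, ← inner_cl (D d) l2]
  have t1 : Filter.Tendsto (fun n => ⟪opZ p (φ n), l1.toLp (pd d ψ)⟫ + ⟪opP p d (φ n), l2.toLp ψ⟫) Filter.atTop
      (nhds (⟪U, l1.toLp (pd d ψ)⟫ + ⟪D d, l2.toLp ψ⟫)) :=
    (hU.inner tendsto_const_nhds).add ((hD d).inner tendsto_const_nhds)
  have t2 : (fun n => ⟪opZ p (φ n), l1.toLp (pd d ψ)⟫ + ⟪opP p d (φ n), l2.toLp ψ⟫) = fun _ => (0:ℝ) := by
    funext n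
    rw [← ibp_tri (φ n) h1 d]
    exact congrArg₂ (· + ·) (inner_cl2 (l2T p (φ n).2.1.cont) l1) (inner_cl2 (l2T p ((φ n).2.1.pd d).cont) l2)
  rw [t2] at t1
  exact tendsto_nhds_unique t1 tendsto_const_nhds

/-- integrating by parts twice -/
lemma weak_lap {p : Fin 3 → E2} {ξ : E2 → ℝ} {G : Fin 2 → E2 → ℝ} {Hs : Fin 2 → Fin 2 → E2 → ℝ}
    (h : MemH2W (tri p) ξ G Hs) (v : TD p) :
    ∫ x in tri p, ξ x * lap v.1 x = ∫ x in tri p, (Hs 0 0 x + Hs 1 1 x) * v.1 x := by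
  obtain ⟨lξ, hG, hH⟩ := h
  have e : ∀ i, ∫ x in tri p, ξ x * pd i (pd i v.1) x = ∫ x in tri p, Hs i i x * v.1 x := by
    intro i
    have e1 := (hG i).2 (pd i v.1) (pdT v i).2.1.sm (pdT v i).2.1.cs (pdT v i).2.2
    have e2 := (hH i i).2 v.1 v.2.1.sm v.2.1.cs v.2.2
    have e3 : ∫ x in tri p, ξ x * pd i (pd i v.1) x = - ∫ x in tri p, G i x * pd i v.1 x := e1
    have e4 : ∫ x in tri p, G i x * pd i v.1 x = - ∫ x in tri p, Hs i i x * v.1 x := e2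
    rw [e3, e4, neg_neg]
  simp only [lap_eq, mul_add, add_mul]
  rw [integral_add (l2mul lξ ((v.2.1.pd 0).pd 0).cont) (l2mul lξ ((v.2.1.pd 1).pd 1).cont),
    integral_add (l2mul (hH 0 0).1 v.2.1.cont) (l2mul (hH 1 1).1 v.2.1.cont), e, e]

def lapT {p : Fin 3 → E2} (v : TD p) : TD p := ⟨lap v.1, v.2.1.lap, (lap_supp _).trans v.2.2⟩

lemma exists_sol {p : Fin 3 → E2} (hp : ccw p) {f g : Fin 3 → ℝ → ℝ}
    (hmem : MemBdryH2H1 f g) (hcomp : Compat p f g) {ρ : E2 → ℝ} (hρ : L2on (tri p) ρ) :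
    ∃ ξ G Hs, MemH2W (tri p) ξ G Hs ∧ TraceW p ξ G Hs f g ∧
        ∀ φ : E2 → ℝ, ContDiff ℝ (⊤ : ℕ∞) φ → HasCompactSupport φ → tsupport φ ⊆ tri p →
          ∫ x in tri p, ξ x * lap (lap φ) x = ∫ x in tri p, ρ x * φ x := by
  obtain ⟨ζ, Gz, Hz, hC, hb⟩ := lift_exists hp hmem hcomp
  obtain ⟨C, hC0, hB⟩ := op_bounds p
  have lh : L2on (tri p) (fun x => Hz 0 0 x + Hz 1 1 x) := (hC.lH 0 0).add (hC.lH 1 1)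
  let R : LTr p := hρ.toLp ρ
  let h : LTr p := lh.toLp _
  let l : TD p →ₗ[ℝ] ℝ := (innerSL ℝ R).toLinearMap ∘ₗ opZ p - (innerSL ℝ h).toLinearMap ∘ₗ opA p
  have hl : ∀ v, l v = ⟪R, opZ p v⟫ - ⟪h, opA p v⟫ := fun v => rfl
  have hlb : ∀ v, |l v| ≤ (‖R‖ * C + ‖h‖) * ‖opA p v‖ := by
    intro v
    rw [hl]
    have b1 := abs_real_inner_le_norm R (opZ p v)
    have b2 := abs_real_inner_le_norm h (opA p v)
    have b3 := mul_le_mul_of_nonneg_left (hB v).1 (norm_nonneg R)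
    have := abs_sub (⟪R, opZ p v⟫ : ℝ) ⟪h, opA p v⟫
    linarith
  obtain ⟨k, hk, hkl⟩ := hilbert_solve (opA p) l _ hlb
  obtain ⟨y, hy, hyk⟩ := mem_closure_iff_seq_limit.1 (show k ∈ closure (LinearMap.range (opA p) : Set (LTr p)) from hk)
  choose φ hφ using hy
  have hA : Filter.Tendsto (fun n => opA p (φ n)) Filter.atTop (nhds k) := by simpa only [hφ] using hyk
  obtain ⟨w, hw⟩ := bdd_limit _ (opZ p) C (fun v => (hB v).1) φ k hA
  choose Gw hGw using fun i => bdd_limit _ (opP p i) C (fun v => (hB v).2.1 i) φ k hA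
  choose Hw hHw using fun i j => bdd_limit _ (opQ p i j) C (fun v => (hB v).2.2 i j) φ k hA
  have hkH : k = Hw 0 0 + Hw 1 1 := tendsto_nhds_unique hA ((hHw 0 0).add (hHw 1 1))
  have tw0 := hft_limit φ w Gw hw hGw
  have tw1 : ∀ i, HasFaceTrace p (Gw i) (fun d => Hw i d) (fun _ _ => 0) := fun i =>
    hft_limit (fun n => pdT (φ n) i) (Gw i) (Hw i) (hGw i) (hHw i)
  have lζ := l2T p hC.cξ
  have lGz := fun d => l2T p (hC.cG d)
  have ce : ∀ j, Continuous (epar p j) := epar_cont p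
  have t0 := hft_add hC.t0 tw0 lζ (Lp.memLp w) lGz (fun d => Lp.memLp (Gw d))
    (fun j => (hC.cξ.comp (ce j)).continuousOn) (fun j => continuousOn_const)
  have t1 := fun i => hft_add (hC.t1 i) (tw1 i) (lGz i) (Lp.memLp (Gw i)) (hC.lH i) (fun d => Lp.memLp (Hw i d))
    (fun j => ((hC.cG i).comp (ce j)).continuousOn) (fun j => continuousOn_const)
  have hM := hft_memH2W hp (lζ.add (Lp.memLp w)) (fun d => (lGz d).add (Lp.memLp (Gw d)))
    (fun d d' => (hC.lH d d').add (Lp.memLp (Hw d d'))) t0 t1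
  refine ⟨_, _, _, hM, ⟨hft_congr t0 fun j t ht => by simp [(hb j t ht).1],
    fun d => hft_congr (t1 d) fun j t ht => by simp [(hb j t ht).2 d]⟩, ?_⟩
  intro ψ h1 h2 h3
  let v : TD p := ⟨ψ, ⟨h1, h2⟩, h3⟩
  have e1 := weak_lap hM (lapT v)
  refine e1.trans ?_
  have lc : Continuous (lap ψ) := (lapT v).2.1.cont
  have e2 : ∫ x in tri p, (Hz 0 0 x + Hw 0 0 x + (Hz 1 1 x + Hw 1 1 x)) * lap ψ x
      = (∫ x in tri p, (Hz 0 0 x + Hz 1 1 x) * lap ψ x) + ∫ x in tri p, k x * lap ψ x := by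
    rw [← integral_add (l2mul lh lc) (l2mul (Lp.memLp k) lc)]
    apply integral_congr_ae
    have := Lp.coeFn_add (Hw 0 0) (Hw 1 1)
    rw [← hkH] at this
    filter_upwards [this] with x hx
    rw [hx, Pi.add_apply]; ring
  refine e2.trans ?_
  have e3 := hkl v
  rw [hl, opA_eq] at e3
  have e4 : ⟪k, (l2T p v.2.1.lap.cont).toLp (lap v.1)⟫ = ∫ x in tri p, k x * lap ψ x := inner_cl _ _
  have e5 : ⟪h, (l2T p v.2.1.lap.cont).toLp (lap v.1)⟫ = ∫ x in tri p, (Hz 0 0 x + Hz 1 1 x) * lap ψ x := inner_cl2 _ _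
  have e6 : ⟪R, opZ p v⟫ = ∫ x in tri p, ρ x * ψ x := inner_cl2 hρ (l2T p v.2.1.cont)
  rw [e4, e5, e6] at e3
  rw [e3]; ring

lemma aff_int {F : E2 → ℝ} (hF : Integrable F) {s : ℝ} (hs : 1 ≤ s) (b : E2) :
    Integrable (fun x => F (s • x + b)) ∧ ∫ x, F (s • x + b) = (s ^ 2)⁻¹ * ∫ x, F x := by
  have s0 : s ≠ 0 := by linarith
  have h1 : Integrable (fun x => F (x + b)) := hF.comp_add_right b
  refine ⟨h1.comp_smul s0, ?_⟩
  rw [Measure.integral_comp_smul volume (fun x => F (x + b)) s, integral_add_right_eq_self F b]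
  simp

lemma aff_le {F : E2 → ℝ} (hF : Integrable F) (h0 : ∀ x, 0 ≤ F x) {s : ℝ} (hs : 1 ≤ s) (b : E2) :
    ∫ x, F (s • x + b) ≤ ∫ x, F x := by
  rw [(aff_int hF hs b).2]
  have : 0 ≤ ∫ x, F x := integral_nonneg h0
  have h2 : (s ^ 2)⁻¹ ≤ 1 := inv_le_one_of_one_le₀ (one_le_pow₀ hs)
  nlinarith

lemma cc_small {v : E2 → ℝ} (hv : Continuous v) (hc : HasCompactSupport v) {δ : ℝ} (hδ : 0 < δ) :
    ∃ e > 0, ∀ (s : ℝ) (b : E2), 1 ≤ s → s ≤ 1 + e → ‖b‖ ≤ e → ∫ x, (v (s • x + b) - v x) ^ 2 ≤ δ := by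
  obtain ⟨R, hR⟩ := hc.isCompact.isBounded.subset_closedBall 0
  have cont : Continuous (fun q : ℝ × E2 => ∫ x in Metric.closedBall (0:E2) (R + 1), (v (q.1 • x + q.2) - v x) ^ 2) := by
    apply continuous_parametric_integral_of_continuous
    · fun_prop
    · exact isCompact_closedBall _ _
  have ht := cont.tendsto (1, 0)
  simp only [one_smul, add_zero, sub_self, ne_eq, OfNat.ofNat_ne_zero, not_false_eq_true, zero_pow, integral_zero] at ht
  have ev := ht.eventually (gt_mem_nhds hδ)
  rw [Metric.eventually_nhds_iff] at ev
  obtain ⟨e, he, hev⟩ := ev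
  refine ⟨min (e / 2) 1, by positivity, fun s b h1 h2 h3 => ?_⟩
  have m1 : min (e / 2) 1 ≤ e / 2 := min_le_left _ _
  have m2 : min (e / 2) 1 ≤ 1 := min_le_right _ _
  have hd : dist ((s, b) : ℝ × E2) (1, 0) < e := by
    rw [Prod.dist_eq, max_lt_iff, dist_zero_right, Real.dist_eq, abs_of_nonneg (by linarith)]
    constructor <;> dsimp only <;> linarith
  have := hev hd
  dsimp only at this
  rw [setIntegral_eq_integral_of_forall_compl_eq_zero] at this
  · exact this.le
  intro x hx
  have hx' : R + 1 < ‖x‖ := by simpa using hx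
  have hz : ∀ y : E2, R < ‖y‖ → v y = 0 := by
    intro y hy
    apply image_eq_zero_of_notMem_tsupport
    intro hm
    have := hR hm
    rw [mem_closedBall_zero_iff] at this
    linarith
  have hn : R < ‖s • x + b‖ := by
    have a1 : ‖s • x‖ ≤ ‖s • x + b‖ + ‖b‖ := by
      have := norm_sub_le (s • x + b) b
      simpa using this
    rw [norm_smul, Real.norm_eq_abs, abs_of_nonneg (by linarith)] at a1
    nlinarith [norm_nonneg x]
  rw [hz _ hn, hz x (by linarith)]
  simp

lemma trans_small {w : E2 → ℝ} (hw : Integrable w) (hw2 : Integrable (fun x => w x ^ 2)) {δ : ℝ} (hδ : 0 < δ) :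
    ∃ e > 0, ∀ (s : ℝ) (b : E2), 1 ≤ s → s ≤ 1 + e → ‖b‖ ≤ e → ∫ x, (w (s • x + b) - w x) ^ 2 ≤ δ := by
  have hm : MemLp w 2 volume := (memLp_two_iff_integrable_sq hw.1).2 hw2
  obtain ⟨v, vc, hv, vcont, -⟩ := MemLp.exists_hasCompactSupport_integral_rpow_sub_le (p := 2) (by norm_num)
    (f := w) (μ := volume) (by simpa using hm) (show 0 < δ / 9 by positivity)
  have hv' : ∫ x, (w x - v x) ^ 2 ≤ δ / 9 := by
    simpa [Real.rpow_two] using hv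
  have vm : MemLp v 2 volume := vcont.memLp_of_hasCompactSupport vc
  have vi : Integrable v := vcont.integrable_of_hasCompactSupport vc
  have d2 : Integrable (fun x => (w x - v x) ^ 2) := (hm.sub vm).integrable_sq
  obtain ⟨e, he, H⟩ := cc_small vcont vc (show 0 < δ / 9 by positivity)
  refine ⟨e, he, fun s b h1 h2 h3 => ?_⟩
  have k1 := H s b h1 h2 h3
  have k2 := (aff_le d2 (fun _ => sq_nonneg _) h1 b).trans hv'
  have vm' : MemLp (fun x => v (s • x + b)) 2 volume :=
    (memLp_two_iff_integrable_sq (aff_int vi h1 b).1.1).2 (aff_int vm.integrable_sq h1 b).1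
  have i3 : Integrable (fun x => (v (s • x + b) - v x) ^ 2) := (vm'.sub vm).integrable_sq
  have i2 := (aff_int d2 h1 b).1
  have hw' : MemLp (fun x => w (s • x + b)) 2 volume :=
    (memLp_two_iff_integrable_sq (aff_int hw h1 b).1.1).2 (aff_int hw2 h1 b).1
  have i0 : Integrable (fun x => (w (s • x + b) - w x) ^ 2) := (hw'.sub hm).integrable_sq
  have i12 : Integrable (fun x => (w (s • x + b) - v (s • x + b)) ^ 2 + (v (s • x + b) - v x) ^ 2) := i2.add i3
  have i123 : Integrable (fun x => (w (s • x + b) - v (s • x + b)) ^ 2 + (v (s • x + b) - v x) ^ 2 + (w x - v x) ^ 2) :=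
    i12.add d2
  calc ∫ x, (w (s • x + b) - w x) ^ 2 ≤ ∫ x, 3 * ((w (s • x + b) - v (s • x + b)) ^ 2 + (v (s • x + b) - v x) ^ 2 + (w x - v x) ^ 2) := by
        refine integral_mono i0 (i123.const_mul 3) fun x => ?_
        dsimp only
        nlinarith [sq_nonneg ((w (s • x + b) - v (s • x + b)) - (v (s • x + b) - v x)),
          sq_nonneg ((w (s • x + b) - v (s • x + b)) + (w x - v x)), sq_nonneg ((v (s • x + b) - v x) + (w x - v x))]
    _ ≤ δ := by
        rw [integral_const_mul, integral_add i12 d2, integral_add i2 i3]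
        linarith

lemma approx_pair {w : E2 → ℝ} (hw : Integrable w) (hw2 : Integrable (fun x => w x ^ 2)) {δ : ℝ} (hδ : 0 < δ) :
    ∃ e > 0, ∀ (s : ℝ) (b : E2) (η : E2 → ℝ), 1 ≤ s → s ≤ 1 + e → Continuous η → HasCompactSupport η →
      (∀ z, 0 ≤ η z) → ∫ z, η z = 1 → (∀ z, η z ≠ 0 → ‖b‖ + ‖z‖ ≤ e) →
      ∫ x, w x ^ 2 ≤ 2 * (∫ x, w x * ∫ y, w y * η (s • x + b - y)) + δ := by
  obtain ⟨e, he, H⟩ := trans_small hw hw2 hδ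
  refine ⟨e, he, fun s b η h1 h2 ηc ηs η0 η1 ηe => ?_⟩
  have hm : MemLp w 2 volume := (memLp_two_iff_integrable_sq hw.1).2 hw2
  obtain ⟨Mη, hMη⟩ := ηs.exists_bound_of_continuous ηc
  have int1 : Integrable (fun q : E2 × E2 => w q.1 * w q.2 * η (s • q.1 + b - q.2)) (volume.prod volume) :=
    (hw.mul_prod hw).mul_bdd (c := Mη) (by fun_prop) (Filter.Eventually.of_forall fun q => hMη _)
  have mp : MeasurePreserving (fun q : E2 × E2 => (q.1, s • q.1 + b - q.2)) (volume.prod volume) (volume.prod volume) := by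
    refine MeasurePreserving.skew_product (MeasurePreserving.id volume) (g := fun x z => s • x + b - z) (by unfold Function.uncurry; fun_prop) ?_
    filter_upwards with x
    exact (Measure.measurePreserving_sub_left volume (s • x + b)).map_eq
  have int2 : Integrable (fun q : E2 × E2 => w q.1 * w (s • q.1 + b - q.2) * η q.2) (volume.prod volume) := by
    have := mp.integrable_comp_of_integrable int1
    simpa [Function.comp_def] using this
  have sw : ∫ x, w x * ∫ y, w y * η (s • x + b - y) = ∫ z, η z * ∫ x, w x * w (s • x + b - z) := by
    have e1 : ∀ x, w x * ∫ y, w y * η (s • x + b - y) = ∫ z, w x * w (s • x + b - z) * η z := by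
      intro x
      rw [← integral_sub_left_eq_self (fun y => w y * η (s • x + b - y)) volume (s • x + b), ← integral_const_mul]
      congr 1; funext z; simp; ring
    simp only [e1]
    rw [integral_integral_swap int2]
    congr 1; funext z
    rw [← integral_const_mul]
    congr 1; funext x; ring
  have int3 : Integrable (fun z => η z * ∫ x, w x * w (s • x + b - z)) := by
    have := int2.integral_prod_right
    refine this.congr (Filter.Eventually.of_forall fun z => ?_)
    dsimp only
    rw [← integral_const_mul]
    congr 1; funext x; ring
  have low : ∀ z, η z ≠ 0 → (∫ x, w x ^ 2) / 2 - δ / 2 ≤ ∫ x, w x * w (s • x + b - z) := by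
    intro z hz
    have hb : ‖b - z‖ ≤ e := (norm_sub_le _ _).trans (ηe z hz)
    have k := H s (b - z) h1 h2 hb
    have j1 := (aff_int hw h1 (b - z)).1
    have j2 := (aff_int hw2 h1 (b - z)).1
    have hw' : MemLp (fun x => w (s • x + (b - z))) 2 volume := (memLp_two_iff_integrable_sq j1.1).2 j2
    have i0 : Integrable (fun x => (w (s • x + (b - z)) - w x) ^ 2) := (hw'.sub hm).integrable_sq
    have ip : Integrable (fun x => w x * w (s • x + (b - z))) := hm.integrable_mul hw'
    have := integral_mono (hw2.sub i0) (ip.const_mul 2) (fun x => by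
      show w x ^ 2 - (w (s • x + (b - z)) - w x) ^ 2 ≤ 2 * (w x * w (s • x + (b - z)))
      nlinarith [sq_nonneg (w (s • x + (b - z)))])
    rw [integral_sub' hw2 i0, integral_const_mul] at this
    simp only [add_sub_assoc]
    linarith
  have ηi : Integrable η := ηc.integrable_of_hasCompactSupport ηs
  have fin : ∫ z, η z * ((∫ x, w x ^ 2) / 2 - δ / 2) ≤ ∫ z, η z * ∫ x, w x * w (s • x + b - z) := by
    refine integral_mono (ηi.mul_const _) int3 fun z => ?_
    by_cases hz : η z = 0
    · simp [hz]
    · exact mul_le_mul_of_nonneg_left (low z hz) (η0 z)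
  rw [integral_mul_const, η1, ← sw] at fin
  linarith

def cv (u η : E2 → ℝ) (z : E2) : ℝ := ∫ y, u y * η (z - y)

lemma cv_eq (u η : E2 → ℝ) : cv u η = convolution u η (ContinuousLinearMap.mul ℝ ℝ) volume := rfl

lemma cv_sm {u η : E2 → ℝ} (hu : Integrable u) (h : Tst η) : ContDiff ℝ (⊤ : ℕ∞) (cv u η) := by
  rw [cv_eq]
  exact h.cs.contDiff_convolution_right _ hu.locallyIntegrable h.sm

lemma pd_cv {u η : E2 → ℝ} (hu : Integrable u) (h : Tst η) (i : Fin 2) : pd i (cv u η) = cv u (pd i η) := by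
  funext z
  have hd := h.cs.hasFDerivAt_convolution_right (ContinuousLinearMap.mul ℝ ℝ) (μ := volume)
    hu.locallyIntegrable (h.sm.of_le (by simp)) z
  unfold pd
  rw [cv_eq, hd.fderiv, convolution_precompR_apply _ hu.locallyIntegrable (h.cs.fderiv ℝ)
    (h.sm.continuous_fderiv (by simp))]
  rfl

lemma pd_aff {F : E2 → ℝ} (hF : Differentiable ℝ F) (s : ℝ) (b : E2) (i : Fin 2) :
    pd i (fun x => F (s • x + b)) = fun x => s * pd i F (s • x + b) := by
  funext x
  have h1 : HasFDerivAt (fun x : E2 => s • x + b) (s • ContinuousLinearMap.id ℝ E2) x :=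
    ((hasFDerivAt_id x).const_smul s).add_const b
  have := (hF (s • x + b)).hasFDerivAt.comp x h1
  unfold pd
  have e : fderiv ℝ (fun x => F (s • x + b)) x = _ := this.fderiv
  rw [e]; simp

lemma lap_aff {F : E2 → ℝ} (hF : ContDiff ℝ (⊤ : ℕ∞) F) (s : ℝ) (b : E2) (x : E2) :
    lap (fun x => F (s • x + b)) x = s ^ 2 * lap F (s • x + b) := by
  have k : ∀ i, pd i (pd i (fun x => F (s • x + b))) x = s ^ 2 * pd i (pd i F) (s • x + b) := by
    intro i
    rw [pd_aff (hF.differentiable (by simp))]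
    have hG : Differentiable ℝ (fun y => s * pd i F y) :=
      ((pd_sm hF i).differentiable (by simp)).const_mul s
    rw [pd_aff hG s b i]
    have : pd i (fun y => s * pd i F y) (s • x + b) = s * pd i (pd i F) (s • x + b) := by
      unfold pd
      have hd : DifferentiableAt ℝ (fun y => fderiv ℝ F y (stdb2 i)) (s • x + b) := (pd_sm hF i).differentiable (by simp) _
      rw [fderiv_const_mul hd]
      simp
    dsimp only
    rw [this]; ring
  rw [lap_eq, lap_eq]
  simp only [k]; ring

lemma cv_lap {u h η : E2 → ℝ} (hu : Integrable u) (hη : Tst η)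
    (hw : ∀ ψ, Tst ψ → ∫ x, u x * lap ψ x = ∫ x, h x * ψ x) : lap (cv u η) = cv h η := by
  funext z
  have e1 : lap (cv u η) z = cv u (pd 0 (pd 0 η)) z + cv u (pd 1 (pd 1 η)) z := by
    rw [lap_eq]; simp only [pd_cv hu hη, pd_cv hu (hη.pd _)]
  have hr : (fun y => η (z - y)) = fun y => η ((-1 : ℝ) • y + z) := by
    funext y; congr 1; simp [sub_eq_add_neg, add_comm]
  have hψ : Tst (fun y => η (z - y)) := by
    constructor
    · exact hη.sm.comp (contDiff_const.sub contDiff_id)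
    · exact hη.cs.comp_homeomorph (Homeomorph.subLeft z)
  have e2 := hw _ hψ
  have e3 : ∀ y, lap (fun y => η (z - y)) y = lap η (z - y) := by
    intro y
    rw [hr, lap_aff hη.sm]
    have : (-1 : ℝ) • y + z = z - y := by simp [sub_eq_add_neg, add_comm]
    rw [this]; ring
  simp only [e3] at e2
  rw [e1]
  show _ = ∫ y, h y * η (z - y)
  rw [← e2]
  have ci : ∀ ψ : E2 → ℝ, Tst ψ → Integrable (fun y => u y * ψ (z - y)) := by
    intro ψ hψ
    obtain ⟨M, hM⟩ := hψ.cs.exists_bound_of_continuous hψ.cont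
    have := hψ.cont
    exact hu.mul_bdd (c := M) (by fun_prop) (Filter.Eventually.of_forall fun q => hM _)
  have := integral_add (ci _ ((hη.pd 0).pd 0)) (ci _ ((hη.pd 1).pd 1))
  refine this.symm.trans ?_
  congr 1; funext y; rw [lap_eq]; ring

open scoped Pointwise in
lemma mol_mem {p : Fin 3 → E2} {u η : E2 → ℝ} (hu : Integrable u) (hu0 : ∀ x, x ∉ tri p → u x = 0)
    (hη : Tst η) {x0 : E2} {r ε : ℝ} (hball : Metric.ball x0 r ⊆ tri p) (hr : 0 < r) (hε : 0 < ε)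
    (hs : ∀ z, η z ≠ 0 → ‖z‖ ≤ ε * r / 2) :
    (fun x => cv u η ((1 + ε) • x + -(ε • x0))) ∈ TD p := by
  have hc1 : (1:ℝ) + ε ≠ 0 := by positivity
  have sm : ContDiff ℝ (⊤ : ℕ∞) (fun x => cv u η ((1 + ε) • x + -(ε • x0))) :=
    (cv_sm hu hη).comp (by fun_prop)
  let S : Set E2 := convexHull ℝ (range p) + Metric.closedBall (0:E2) (ε * r / 2)
  have hS : IsClosed S := ((hull_compact p).add (isCompact_closedBall _ _)).isClosed
  have hcl : IsClosed ((fun x : E2 => (1 + ε) • x + -(ε • x0)) ⁻¹' S) := hS.preimage (by fun_prop)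
  have sub1 : tsupport (fun x => cv u η ((1 + ε) • x + -(ε • x0))) ⊆ ((fun x : E2 => (1 + ε) • x + -(ε • x0)) ⁻¹' S) := by
    refine closure_minimal ?_ hcl
    intro x hx
    by_contra hn
    apply hx
    show ∫ y, _ = 0
    rw [← integral_zero E2 ℝ]
    congr 1; funext y
    by_cases hy : y ∈ tri p
    · have : η ((1 + ε) • x + -(ε • x0) - y) = 0 := by
        by_contra hne
        apply hn
        refine ⟨y, tri_sub p hy, _, ?_, add_sub_cancel y _⟩
        rw [mem_closedBall_zero_iff]
        exact hs _ hne
      rw [this, mul_zero]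
    · rw [hu0 y hy, zero_mul]
  have sub2 : tsupport (fun x => cv u η ((1 + ε) • x + -(ε • x0))) ⊆ tri p := by
    intro x hx
    obtain ⟨y, hy, e, he, hye⟩ := sub1 hx
    rw [mem_closedBall_zero_iff] at he
    have hq : x0 + ε⁻¹ • e ∈ tri p := by
      apply hball
      rw [mem_ball_iff_norm]
      simp only [add_sub_cancel_left]
      rw [norm_smul, norm_inv, Real.norm_eq_abs, abs_of_pos hε, inv_mul_lt_iff₀ hε]
      nlinarith [mul_pos hε hr]
    have := (convex_convexHull ℝ (range p)).combo_closure_interior_mem_interior (subset_closure hy) hq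
      (a := (1 + ε)⁻¹) (b := (1 + ε)⁻¹ * ε) (by positivity) (by positivity) (by field_simp)
    change x ∈ interior (convexHull ℝ (range p))
    convert this using 1
    have hye' : y + e = (1 + ε) • x + -(ε • x0) := hye
    rw [mul_smul, smul_add ε, smul_inv_smul₀ hε.ne', ← smul_add]
    have : y + (ε • x0 + e) = (1 + ε) • x := by
      rw [← sub_eq_zero]
      have : y + (ε • x0 + e) - (1 + ε) • x = (y + e) - ((1 + ε) • x + -(ε • x0)) := by abel
      rw [this, hye', sub_self]
    rw [this, inv_smul_smul₀ hc1]
  refine ⟨⟨sm, ?_⟩, sub2⟩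
  exact HasCompactSupport.of_support_subset_isCompact (hull_compact p) ((subset_tsupport _).trans (sub2.trans (tri_sub p)))

lemma zero_of_tests {w : E2 → ℝ} (hw : Integrable w) (hw2 : Integrable (fun x => w x ^ 2))
    {x0 : E2} {r : ℝ} (hr : 0 < r)
    (H : ∀ ε > 0, ∀ η, Tst η → (∀ z, η z ≠ 0 → ‖z‖ ≤ ε * r / 2) →
      ∫ x, w x * cv w η ((1 + ε) • x + -(ε • x0)) = 0) : w =ᵐ[volume] 0 := by
  have hz : ∫ x, w x ^ 2 ≤ 0 := by
    refine le_of_forall_pos_le_add fun δ hδ => ?_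
    obtain ⟨e, he, K⟩ := approx_pair hw hw2 hδ
    let ε : ℝ := e / (1 + ‖x0‖ + r)
    have hD : 0 < 1 + ‖x0‖ + r := by positivity
    have hε : 0 < ε := div_pos he hD
    have hεe : ε * (1 + ‖x0‖ + r) = e := div_mul_cancel₀ _ hD.ne'
    let B : ContDiffBump (0 : E2) := ⟨ε * r / 4, ε * r / 2, by positivity, by nlinarith [mul_pos hε hr]⟩
    have hsup : ∀ z, B.normed volume z ≠ 0 → ‖z‖ ≤ ε * r / 2 := by
      intro z hz
      have : z ∈ Function.support (B.normed volume) := hz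
      rw [B.support_normed_eq, mem_ball_zero_iff] at this
      exact this.le
    have hT : Tst (B.normed volume) := ⟨B.contDiff_normed, B.hasCompactSupport_normed⟩
    have k := K (1 + ε) (-(ε • x0)) (B.normed volume) (by linarith) (by nlinarith [mul_nonneg hε.le (norm_nonneg x0), mul_pos hε hr])
      hT.cont hT.cs B.nonneg_normed B.integral_normed (by
        intro z hz
        have := hsup z hz
        rw [norm_neg, norm_smul, Real.norm_eq_abs, abs_of_pos hε]
        nlinarith [mul_pos hε hr])
    have h0 := H ε hε _ hT hsup
    have h1 : ∫ x, w x * ∫ y, w y * B.normed volume ((1 + ε) • x + -(ε • x0) - y) = 0 := h0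
    rw [h1] at k
    linarith
  have hz' : ∫ x, w x ^ 2 = 0 := le_antisymm hz (integral_nonneg fun _ => sq_nonneg _)
  have := (integral_eq_zero_iff_of_nonneg (fun x => sq_nonneg (w x)) hw2).1 hz'
  filter_upwards [this] with x hx
  simpa using hx

lemma unique_core {p : Fin 3 → E2} {u h : E2 → ℝ} (hu : Integrable u) (hu2 : Integrable (fun x => u x ^ 2))
    (hh : Integrable h) (hh2 : Integrable (fun x => h x ^ 2)) (hu0 : ∀ x, x ∉ tri p → u x = 0)
    (hw : ∀ ψ, Tst ψ → ∫ x, u x * lap ψ x = ∫ x, h x * ψ x)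
    (hb : ∀ v : TD p, ∫ x, h x * lap v.1 x = 0) {x0 : E2} (hx0 : x0 ∈ tri p) : u =ᵐ[volume] 0 := by
  obtain ⟨r, hr, hball⟩ := Metric.isOpen_iff.1 (tri_open p) x0 hx0
  have lapm : ∀ (ε : ℝ) (η : E2 → ℝ), Tst η → ∀ x, lap (fun x => cv u η ((1 + ε) • x + -(ε • x0))) x =
      (1 + ε) ^ 2 * cv h η ((1 + ε) • x + -(ε • x0)) := by
    intro ε η hη x
    rw [lap_aff (cv_sm hu hη), cv_lap hu hη hw]
  have h0 : h =ᵐ[volume] 0 := by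
    refine zero_of_tests hh hh2 (x0 := x0) hr fun ε hε η hη hs => ?_
    have := hb ⟨_, mol_mem hu hu0 hη hball hr hε hs⟩
    simp only [lapm ε η hη] at this
    have e : ∀ x, h x * ((1 + ε) ^ 2 * cv h η ((1 + ε) • x + -(ε • x0))) =
      (1 + ε) ^ 2 * (h x * cv h η ((1 + ε) • x + -(ε • x0))) := fun x => by ring
    simp only [e] at this
    rw [integral_const_mul] at this
    rcases mul_eq_zero.1 this with h1 | h1
    · have : (1 + ε) ^ 2 ≠ 0 := by positivity
      exact absurd h1 this
    · exact h1
  refine zero_of_tests hu hu2 (x0 := x0) hr fun ε hε η hη hs => ?_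
  obtain ⟨hT, hsup⟩ := mol_mem hu hu0 hη hball hr hε hs
  have cz : ∀ z, cv h η z = 0 := by
    intro z
    show ∫ y, _ = 0
    rw [← integral_zero E2 ℝ]
    apply integral_congr_ae
    filter_upwards [h0] with y hy
    rw [hy]; simp
  obtain ⟨R, hR⟩ := (hull_compact p).isBounded.subset_closedBall 0
  have pb := phi_bound hT (hsup.trans ((tri_sub p).trans hR))
  simp only [lapm ε η hη, cz] at pb
  simp only [mul_zero, ne_eq, OfNat.ofNat_ne_zero, not_false_eq_true, zero_pow, integral_zero] at pb
  have i2 : Integrable (fun x => cv u η ((1 + ε) • x + -(ε • x0)) ^ 2) := by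
    simpa only [sq] using (hT.smul hT.sm).int
  have pz := le_antisymm pb (integral_nonneg fun _ => sq_nonneg _)
  have az := (integral_eq_zero_iff_of_nonneg (fun x => sq_nonneg _) i2).1 pz
  rw [← integral_zero E2 ℝ]
  apply integral_congr_ae
  filter_upwards [az] with x hx
  have : cv u η ((1 + ε) • x + -(ε • x0)) = 0 := by simpa using hx
  rw [this, mul_zero]

lemma ext_int {p : Fin 3 → E2} {u : E2 → ℝ} (hu : L2on (tri p) u) :
    Integrable ((tri p).indicator u) ∧ Integrable (fun x => (tri p).indicator u x ^ 2) := by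
  constructor
  · rw [integrable_indicator_iff (tri_meas p)]
    exact MemLp.integrable (q := 2) (by norm_num) hu
  · have e : (fun x => (tri p).indicator u x ^ 2) = (tri p).indicator (fun x => u x ^ 2) := by
      funext x; by_cases hx : x ∈ tri p <;> simp [hx]
    rw [e, integrable_indicator_iff (tri_meas p)]
    exact MemLp.integrable_sq hu

lemma ext_mul {p : Fin 3 → E2} (u ψ : E2 → ℝ) :
    ∫ x, (tri p).indicator u x * ψ x = ∫ x in tri p, u x * ψ x := by
  rw [← integral_indicator (tri_meas p)]
  congr 1; funext x; by_cases hx : x ∈ tri p <;> simp [hx]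

/-- two functions with the same face traces: the difference integrates by parts without boundary terms -/
lemma hft_diff {p : Fin 3 → E2} {u u' : E2 → ℝ} {D D' : Fin 2 → E2 → ℝ} {b : Fin 3 → ℝ → ℝ}
    (h : HasFaceTrace p u D b) (h' : HasFaceTrace p u' D' b)
    (hu : L2on (tri p) u) (hu' : L2on (tri p) u') (hD : ∀ d, L2on (tri p) (D d))
    (hD' : ∀ d, L2on (tri p) (D' d)) {ψ : E2 → ℝ} (hψ : Tst ψ) (d : Fin 2) :
    ∫ x in tri p, (u' x - u x) * pd d ψ x = - ∫ x in tri p, (D' d x - D d x) * ψ x := by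
  have e1 := (h ψ hψ.sm hψ.cs d).trans (h' ψ hψ.sm hψ.cs d).symm
  have c1 := (hψ.pd d).cont
  have c2 := hψ.cont
  have e2 : ∀ (a : E2 → ℝ) (A : Fin 2 → E2 → ℝ), L2on (tri p) a → L2on (tri p) (A d) →
      ∫ x in tri p, (a x * fderiv ℝ ψ x (stdb2 d) + A d x * ψ x) =
      (∫ x in tri p, a x * pd d ψ x) + ∫ x in tri p, A d x * ψ x := fun a A ha hA =>
    integral_add (l2mul ha c1) (l2mul hA c2)
  rw [e2 u D hu (hD d), e2 u' D' hu' (hD' d)] at e1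
  simp only [sub_mul]
  rw [integral_sub (l2mul hu' c1) (l2mul hu c1), integral_sub (l2mul (hD' d) c2) (l2mul (hD d) c2)]
  linarith

lemma unique_sol {p : Fin 3 → E2} {f g : Fin 3 → ℝ → ℝ} {ξ ξ' : E2 → ℝ} {G G' : Fin 2 → E2 → ℝ}
    {Hs Hs' : Fin 2 → Fin 2 → E2 → ℝ} {ρ : E2 → ℝ}
    (hM : MemH2W (tri p) ξ G Hs) (hT : TraceW p ξ G Hs f g)
    (hE : ∀ φ : E2 → ℝ, ContDiff ℝ (⊤ : ℕ∞) φ → HasCompactSupport φ → tsupport φ ⊆ tri p →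
          ∫ x in tri p, ξ x * lap (lap φ) x = ∫ x in tri p, ρ x * φ x)
    (hM' : MemH2W (tri p) ξ' G' Hs') (hT' : TraceW p ξ' G' Hs' f g)
    (hE' : ∀ φ : E2 → ℝ, ContDiff ℝ (⊤ : ℕ∞) φ → HasCompactSupport φ → tsupport φ ⊆ tri p →
          ∫ x in tri p, ξ' x * lap (lap φ) x = ∫ x in tri p, ρ x * φ x) :
    ξ' =ᵐ[volume.restrict (tri p)] ξ := by
  rcases (tri p).eq_empty_or_nonempty with he | ⟨x0, hx0⟩
  · rw [he, Measure.restrict_empty]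
    exact by simp [Filter.EventuallyEq, ae_iff]
  have lG := fun d => (hM.2.1 d).1
  have lG' := fun d => (hM'.2.1 d).1
  have lH := fun d d' => (hM.2.2 d d').1
  have lH' := fun d d' => (hM'.2.2 d d').1
  have lu : L2on (tri p) (fun x => ξ' x - ξ x) := MemLp.sub hM'.1 hM.1
  have l1 : L2on (tri p) (fun x => Hs 0 0 x + Hs 1 1 x) := MemLp.add (lH 0 0) (lH 1 1)
  have l1' : L2on (tri p) (fun x => Hs' 0 0 x + Hs' 1 1 x) := MemLp.add (lH' 0 0) (lH' 1 1)
  have lh : L2on (tri p) (fun x => (Hs' 0 0 x + Hs' 1 1 x) - (Hs 0 0 x + Hs 1 1 x)) := MemLp.sub l1' l1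
  obtain ⟨u1, u2⟩ := ext_int lu
  obtain ⟨h1, h2⟩ := ext_int lh
  have key := unique_core (p := p) u1 u2 h1 h2 (fun x hx => indicator_of_notMem hx _) ?_ ?_ hx0
  · have := (ae_restrict_iff' (tri_meas p)).2 (key.mono fun x hx hxt => by
      simpa [hxt] using hx : ∀ᵐ x, x ∈ tri p → ξ' x - ξ x = 0)
    filter_upwards [this] with x hx
    linarith
  · intro ψ hψ
    rw [ext_mul, ext_mul]
    have k : ∀ i, ∫ x in tri p, (ξ' x - ξ x) * pd i (pd i ψ) x = ∫ x in tri p, (Hs' i i x - Hs i i x) * ψ x := by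
      intro i
      rw [hft_diff hT.1 hT'.1 hM.1 hM'.1 lG lG' (hψ.pd i) i,
        hft_diff (hT.2 i) (hT'.2 i) (lG i) (lG' i) (lH i) (lH' i) hψ i, neg_neg]
    have hd : ∀ i, L2on (tri p) (fun x => Hs' i i x - Hs i i x) := fun i => MemLp.sub (lH' i i) (lH i i)
    have e1 : ∫ x in tri p, (ξ' x - ξ x) * lap ψ x = (∫ x in tri p, (ξ' x - ξ x) * pd 0 (pd 0 ψ) x)
        + ∫ x in tri p, (ξ' x - ξ x) * pd 1 (pd 1 ψ) x := by
      rw [← integral_add (l2mul lu ((hψ.pd 0).pd 0).cont) (l2mul lu ((hψ.pd 1).pd 1).cont)]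
      congr 1; funext x; rw [lap_eq]; ring
    rw [e1, k, k, ← integral_add (l2mul (hd 0) hψ.cont) (l2mul (hd 1) hψ.cont)]
    congr 1; funext x; ring
  · intro v
    rw [ext_mul]
    have w1 := weak_lap hM (lapT v)
    have w2 := weak_lap hM' (lapT v)
    have a1 := hE v.1 v.2.1.sm v.2.1.cs v.2.2
    have a2 := hE' v.1 v.2.1.sm v.2.1.cs v.2.2
    have b1 : ∫ x in tri p, (Hs 0 0 x + Hs 1 1 x) * lap v.1 x = ∫ x in tri p, ρ x * v.1 x := w1.symm.trans a1
    have b2 : ∫ x in tri p, (Hs' 0 0 x + Hs' 1 1 x) * lap v.1 x = ∫ x in tri p, ρ x * v.1 x := w2.symm.trans a2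
    have c := v.2.1.lap.cont
    have s := integral_sub (l2mul l1' c) (l2mul l1 c)
    rw [b1, b2, sub_self] at s
    rw [← s]
    congr 1; funext x; ring


theorem biharmonic_well_posedness
    (p : Fin 3 → E2) (hp : ccw p) (f g : Fin 3 → ℝ → ℝ)
    (hmem : MemBdryH2H1 f g) (hcomp : Compat p f g)
    (ρ : E2 → ℝ) (hρ : L2on (tri p) ρ) :
    ∃ ξ G Hs,
      (MemH2W (tri p) ξ G Hs ∧ TraceW p ξ G Hs f g ∧
        ∀ φ : E2 → ℝ, ContDiff ℝ (⊤ : ℕ∞) φ → HasCompactSupport φ → tsupport φ ⊆ tri p →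
          ∫ x in tri p, ξ x * lap (lap φ) x = ∫ x in tri p, ρ x * φ x) ∧
      ∀ ξ' G' Hs',
        (MemH2W (tri p) ξ' G' Hs' ∧ TraceW p ξ' G' Hs' f g ∧
          ∀ φ : E2 → ℝ, ContDiff ℝ (⊤ : ℕ∞) φ → HasCompactSupport φ → tsupport φ ⊆ tri p →
            ∫ x in tri p, ξ' x * lap (lap φ) x = ∫ x in tri p, ρ x * φ x) →
        ξ' =ᵐ[volume.restrict (tri p)] ξ := by
  obtain ⟨ξ, G, Hs, hM, hT, hE⟩ := exists_sol hp hmem hcomp hρ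
  exact ⟨ξ, G, Hs, ⟨hM, hT, hE⟩, fun ξ' G' Hs' h => unique_sol hM hT hE h.1 h.2.1 h.2.2⟩
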